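/- arXiv:2502.15101 — 14 statements merged into one kernel-verified Lean document; each statement's English description precedes it below -/
import Mathlib

section
/- If the point (x, y, z) satisfies x² + y² + z² + Exyz − Ax − By − Cz − D = 0, then for every t ∈ ℂ the point (x(t), y(t), z) again satisfies the equation, i.e. x(t)² + y(t)² + z² + E·x(t)·y(t)·z − A·x(t) − B·y(t) − C·z − D = 0. In other words, the flow φ^z_t maps the fiber {(u,v) ∈ ℂ² : u² + v² + z² + Euvz − Au − Bv − Cz − D = 0} into itself for every t ∈ ℂ. -/
/-- The first coordinate `x(t)` of the flow `φ^z_t` of the vector field `V^z`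
on the Markov-type surface. -/
noncomputable def xFlow (A B E z γ x y t : ℂ) : ℂ :=
  (x - (2*A - B*E*z)/γ^2) * Complex.cos (γ*t)
    + (2*y + E*x*z - B) * Complex.sin (γ*t) / γ + (2*A - B*E*z)/γ^2

/-- The second coordinate `y(t)` of the flow `φ^z_t` of the vector field `V^z`
on the Markov-type surface. -/
noncomputable def yFlow (A B E z γ x y t : ℂ) : ℂ :=
  -(2*x + E*y*z - A) * Complex.sin (γ*t) / γ
    + (y - (2*B - A*E*z)/γ^2) * Complex.cos (γ*t) + (2*B - A*E*z)/γ^2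

/-- A conic with centre `(p, q)` is preserved by the linear flow about its centre, written with
`c = cos (γ t)` and `s = sin (γ t) / γ`. -/
theorem conic_eq_zero_of_rotation {R : Type*} [CommRing R] (A B K w p q c s x y : R)
    (hA : 2*p + w*q = A) (hB : 2*q + w*p = B) (hcs : c^2 + (4 - w^2) * s^2 = 1)
    (h : x^2 + y^2 + w*x*y - A*x - B*y + K = 0) :
    ((x - p)*c + (2*y + w*x - B)*s + p)^2 + (-(2*x + w*y - A)*s + (y - q)*c + q)^2
      + w * ((x - p)*c + (2*y + w*x - B)*s + p) * (-(2*x + w*y - A)*s + (y - q)*c + q)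
      - A * ((x - p)*c + (2*y + w*x - B)*s + p)
      - B * (-(2*x + w*y - A)*s + (y - q)*c + q) + K = 0 := by
  subst hA hB
  linear_combination h + ((x - p)^2 + (y - q)^2 + w*(x - p)*(y - q)) * hcs

/-- If `(x, y, z)` satisfies `x² + y² + z² + Exyz − Ax − By − Cz − D = 0`, then for every
`t ∈ ℂ` the point `(x(t), y(t), z)` again satisfies the equation: the flow `φ^z_t` maps
each fiber of the Markov-type surface over `z` into itself. -/
theorem flow_preserves_fiber (A B C D E z γ : ℂ) (hE : E ≠ 0)
    (hγsq : γ^2 = 4 - E^2 * z^2) (hγ : γ ≠ 0) (x y : ℂ)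
    (hxyz : x^2 + y^2 + z^2 + E*x*y*z - A*x - B*y - C*z - D = 0) (t : ℂ) :
    (xFlow A B E z γ x y t)^2 + (yFlow A B E z γ x y t)^2 + z^2
      + E * (xFlow A B E z γ x y t) * (yFlow A B E z γ x y t) * z
      - A * (xFlow A B E z γ x y t) - B * (yFlow A B E z γ x y t) - C*z - D = 0 := by
  have hγ2 : γ^2 ≠ 0 := pow_ne_zero 2 hγ
  have hA : 2 * ((2*A - B*E*z)/γ^2) + E*z * ((2*B - A*E*z)/γ^2) = A := by
    field_simp
    linear_combination -A * hγsq
  have hB : 2 * ((2*B - A*E*z)/γ^2) + E*z * ((2*A - B*E*z)/γ^2) = B := by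
    field_simp
    linear_combination -B * hγsq
  have hcs : Complex.cos (γ*t)^2 + (4 - (E*z)^2) * (Complex.sin (γ*t) / γ)^2 = 1 := by
    rw [mul_pow, ← hγsq, div_pow, mul_div_cancel₀ _ hγ2, Complex.cos_sq_add_sin_sq]
  have key := conic_eq_zero_of_rotation A B (z^2 - C*z - D) (E*z) _ _ _ _ x y hA hB hcs
    (by linear_combination hxyz)
  unfold xFlow yFlow
  linear_combination key
end

section
/- For every (x,y) ∈ ℂ², the curve t ↦ (x(t), y(t)) satisfies x(0) = x, y(0) = y, and for every t ∈ ℂ the complex derivatives are x′(t) = 2·y(t) + E·x(t)·z − B and y′(t) = −(2·x(t) + E·y(t)·z − A). That is, t ↦ φ^z_t(x,y) is an integral curve, defined on all of ℂ, of the vector field V^z = (2y + Exz − B)·∂/∂x − (2x + Eyz − A)·∂/∂y. -/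
/-- For every `(x, y) ∈ ℂ²`, the curve `t ↦ (x(t), y(t))` satisfies `x(0) = x`, `y(0) = y`,
and for every `t ∈ ℂ` the complex derivatives are `x′(t) = 2y(t) + E·x(t)·z − B` and
`y′(t) = −(2x(t) + E·y(t)·z − A)`; i.e. `t ↦ φ^z_t(x,y)` is an integral curve, defined on
all of `ℂ`, of the vector field `V^z = (2y + Exz − B)∂/∂x − (2x + Eyz − A)∂/∂y`. -/
theorem flow_is_integral_curve (A B C D E z γ : ℂ) (hE : E ≠ 0)
    (hγsq : γ^2 = 4 - E^2 * z^2) (hγ : γ ≠ 0) (x y : ℂ) :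
    xFlow A B E z γ x y 0 = x ∧ yFlow A B E z γ x y 0 = y ∧
    ∀ t : ℂ,
      HasDerivAt (fun s => xFlow A B E z γ x y s)
        (2 * yFlow A B E z γ x y t + E * xFlow A B E z γ x y t * z - B) t ∧
      HasDerivAt (fun s => yFlow A B E z γ x y s)
        (-(2 * xFlow A B E z γ x y t + E * yFlow A B E z γ x y t * z - A)) t := by
  set p : ℂ := (2*A - B*E*z)/γ^2 with hp
  set q : ℂ := (2*B - A*E*z)/γ^2 with hq
  have hA : A = 2*p + E*q*z := by
    rw [hp, hq]
    field_simp
    linear_combination A * hγsq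
  have hB : B = 2*q + E*p*z := by
    rw [hp, hq]
    field_simp
    linear_combination B * hγsq
  have hlin (t : ℂ) : HasDerivAt (fun s => γ * s) γ t := by
    simpa using (hasDerivAt_id t).const_mul γ
  have hx (t : ℂ) : xFlow A B E z γ x y t =
      (x - p) * Complex.cos (γ*t) + (2*y + E*x*z - B) * Complex.sin (γ*t) / γ + p := rfl
  have hy (t : ℂ) : yFlow A B E z γ x y t =
      -(2*x + E*y*z - A) * Complex.sin (γ*t) / γ + (y - q) * Complex.cos (γ*t) + q := rfl
  clear_value p q
  simp only [hx, hy]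
  refine ⟨by simp, by simp, fun t => ⟨?_, ?_⟩⟩
  · refine HasDerivAt.congr_deriv ((((hlin t).ccos.const_mul (x - p)).add
      (((hlin t).csin.const_mul (2*y + E*x*z - B)).div_const γ)).add_const p) ?_
    rw [hA, hB]
    field_simp
    linear_combination (p - x) * Complex.sin (γ*t) * hγsq
  · refine HasDerivAt.congr_deriv
      (((((hlin t).csin.const_mul (-(2*x + E*y*z - A))).div_const γ).add
      ((hlin t).ccos.const_mul (y - q))).add_const q) ?_
    rw [hA, hB]
    field_simp
    linear_combination (q - y) * Complex.sin (γ*t) * hγsq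
end

section
/- The maps φ^z_t form a one-parameter group of transformations of ℂ²: φ^z_0(x,y) = (x,y) and φ^z_{s+t}(x,y) = φ^z_s(φ^z_t(x,y)) for all s, t ∈ ℂ and all (x,y) ∈ ℂ². In particular each φ^z_t is a bijection of ℂ² with inverse φ^z_{−t}. -/
/-- The flow map `φ^z_t : ℂ² → ℂ²`. -/
noncomputable def phiZ (A B E z γ : ℂ) (t : ℂ) (p : ℂ × ℂ) : ℂ × ℂ :=
  (xFlow A B E z γ p.1 p.2 t, yFlow A B E z γ p.1 p.2 t)

theorem equilibrium_eq {A B E z γ : ℂ} (hγsq : γ^2 = 4 - E^2 * z^2) (hγ : γ ≠ 0) :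
    2 * ((2*A - B*E*z)/γ^2) + E * z * ((2*B - A*E*z)/γ^2) = A := by
  field_simp
  linear_combination -A * hγsq

theorem phiZ_zero (A B E z γ : ℂ) (p : ℂ × ℂ) : phiZ A B E z γ 0 p = p := by
  simp [phiZ, xFlow, yFlow]

theorem phiZ_add {A B E z γ : ℂ} (hγsq : γ^2 = 4 - E^2 * z^2) (hγ : γ ≠ 0)
    (s t : ℂ) (p : ℂ × ℂ) :
    phiZ A B E z γ (s + t) p = phiZ A B E z γ s (phiZ A B E z γ t p) := by
  have hA := equilibrium_eq (A := A) (B := B) hγsq hγ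
  have hB := equilibrium_eq (A := B) (B := A) hγsq hγ
  obtain ⟨x, y⟩ := p
  simp only [phiZ, xFlow, yFlow, mul_add γ s t, Complex.cos_add, Complex.sin_add]
  generalize (2*A - B*E*z)/γ^2 = x₀ at *
  generalize (2*B - A*E*z)/γ^2 = y₀ at *
  subst hA hB
  generalize Complex.cos (γ*s) = cs
  generalize Complex.cos (γ*t) = ct
  obtain ⟨σ, hσ⟩ : ∃ σ, Complex.sin (γ*s) = γ * σ := ⟨_, (mul_div_cancel₀ _ hγ).symm⟩
  obtain ⟨τ, hτ⟩ : ∃ τ, Complex.sin (γ*t) = γ * τ := ⟨_, (mul_div_cancel₀ _ hγ).symm⟩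
  rw [hσ, hτ]
  ext
  · field_simp
    linear_combination (-(x - x₀) * σ * τ) * hγsq
  · field_simp
    linear_combination (-(y - y₀) * σ * τ) * hγsq

/-- The maps `φ^z_t` form a one-parameter group of transformations of `ℂ²`:
`φ^z_0 = id` and `φ^z_{s+t} = φ^z_s ∘ φ^z_t`; in particular each `φ^z_t` is a bijection
of `ℂ²` with inverse `φ^z_{−t}`. -/
theorem flow_one_parameter_group (A B C D E z γ : ℂ) (hE : E ≠ 0)
    (hγsq : γ^2 = 4 - E^2 * z^2) (hγ : γ ≠ 0) :
    (∀ p : ℂ × ℂ, phiZ A B E z γ 0 p = p) ∧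
    (∀ s t : ℂ, ∀ p : ℂ × ℂ,
      phiZ A B E z γ (s + t) p = phiZ A B E z γ s (phiZ A B E z γ t p)) ∧
    (∀ t : ℂ, Function.Bijective (phiZ A B E z γ t) ∧
      ∀ p : ℂ × ℂ, phiZ A B E z γ (-t) (phiZ A B E z γ t p) = p ∧
        phiZ A B E z γ t (phiZ A B E z γ (-t) p) = p) := by
  have hleft (t : ℂ) (p : ℂ × ℂ) : phiZ A B E z γ (-t) (phiZ A B E z γ t p) = p := by
    rw [← phiZ_add hγsq hγ, neg_add_cancel, phiZ_zero]
  have hright (t : ℂ) (p : ℂ × ℂ) : phiZ A B E z γ t (phiZ A B E z γ (-t) p) = p := by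
    rw [← phiZ_add hγsq hγ, add_neg_cancel, phiZ_zero]
  exact ⟨phiZ_zero A B E z γ, phiZ_add hγsq hγ, fun t =>
    ⟨Function.bijective_iff_has_inverse.mpr ⟨_, hleft t, hright t⟩,
      fun p => ⟨hleft t p, hright t p⟩⟩⟩
end

section
/- Let f : ℂ → ℂ be an entire function. Define ψ_t(x,y) := φ^z_{f(z)·t}(x,y). Then: (i) ψ_{s+t} = ψ_s ∘ ψ_t for all s, t ∈ ℂ and ψ_0 = id; (ii) if (x,y) lies in the fiber {(u,v) ∈ ℂ² : u² + v² + z² + Euvz − Au − Bv − Cz − D = 0} then so does ψ_t(x,y) for every t ∈ ℂ; (iii) writing ψ_t(x,y) = (x(t), y(t)), for every t ∈ ℂ the derivatives are x′(t) = f(z)·(2y(t) + E·x(t)·z − B) and y′(t) = −f(z)·(2x(t) + E·y(t)·z − A). That is, the shear vector field f(z)·V^z is complete with flow φ^z_{f(z)·t}. -/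
/-- The flow `ψ_t := φ^z_{f(z)·t}` of the shear vector field `f(z)·V^z`. -/
noncomputable def psiZ (A B E z γ : ℂ) (f : ℂ → ℂ) (t : ℂ) (p : ℂ × ℂ) : ℂ × ℂ :=
  phiZ A B E z γ (f z * t) p

/-- If `γ² = 4 - E²z² ≠ 0`, the vector field `V^z` has an equilibrium, which is the center of the
flow. -/
theorem exists_equilibrium {A B E z γ : ℂ} (hγsq : γ^2 = 4 - E^2 * z^2) (hγ : γ ≠ 0) :
    ∃ a b : ℂ, A = 2*a + E*b*z ∧ B = 2*b + E*a*z ∧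
      (2*A - B*E*z)/γ^2 = a ∧ (2*B - A*E*z)/γ^2 = b := by
  refine ⟨_, _, ?_, ?_, rfl, rfl⟩
  · field_simp
    linear_combination A * hγsq
  · field_simp
    linear_combination B * hγsq

theorem xFlow_eq {A B E z γ a b : ℂ} (hB : B = 2*b + E*a*z)
    (ha : (2*A - B*E*z)/γ^2 = a) (x y t : ℂ) :
    xFlow A B E z γ x y t = a + (x - a) * Complex.cos (γ*t)
      + (2*(y - b) + E*(x - a)*z) * (Complex.sin (γ*t) / γ) := by
  rw [xFlow, ha, hB]
  ring

theorem yFlow_eq {A B E z γ a b : ℂ} (hA : A = 2*a + E*b*z)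
    (hb : (2*B - A*E*z)/γ^2 = b) (x y t : ℂ) :
    yFlow A B E z γ x y t = b + (y - b) * Complex.cos (γ*t)
      - (2*(x - a) + E*(y - b)*z) * (Complex.sin (γ*t) / γ) := by
  rw [yFlow, hb, hA]
  ring

theorem phiZ_mem_fiber {A B C D E z γ : ℂ} (hγsq : γ^2 = 4 - E^2 * z^2) (hγ : γ ≠ 0) (t : ℂ)
    {p : ℂ × ℂ}
    (hp : p.1^2 + p.2^2 + z^2 + E*p.1*p.2*z - A*p.1 - B*p.2 - C*z - D = 0) :
    (phiZ A B E z γ t p).1^2 + (phiZ A B E z γ t p).2^2 + z^2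
      + E * (phiZ A B E z γ t p).1 * (phiZ A B E z γ t p).2 * z
      - A * (phiZ A B E z γ t p).1 - B * (phiZ A B E z γ t p).2 - C*z - D = 0 := by
  obtain ⟨a, b, hA, hB, ha, hb⟩ := exists_equilibrium (A := A) (B := B) hγsq hγ
  have hone : Complex.cos (γ*t)^2 + (4 - E^2 * z^2) * (Complex.sin (γ*t) / γ)^2 = 1 := by
    rw [← hγsq, ← Complex.cos_sq_add_sin_sq (γ*t)]
    field_simp
  simp only [phiZ, xFlow_eq hB ha, yFlow_eq hA hb]
  rw [hA, hB] at hp ⊢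
  linear_combination hp
    + ((p.1 - a)^2 + (p.2 - b)^2 + E * (p.1 - a) * (p.2 - b) * z) * hone

theorem hasDerivAt_phiZ {A B E z γ : ℂ} (hγsq : γ^2 = 4 - E^2 * z^2) (hγ : γ ≠ 0)
    (p : ℂ × ℂ) (t : ℂ) :
    HasDerivAt (fun s => phiZ A B E z γ s p)
      (2 * (phiZ A B E z γ t p).2 + E * (phiZ A B E z γ t p).1 * z - B,
        -(2 * (phiZ A B E z γ t p).1 + E * (phiZ A B E z γ t p).2 * z - A)) t := by
  obtain ⟨a, b, hA, hB, ha, hb⟩ := exists_equilibrium (A := A) (B := B) hγsq hγ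
  have hlin : HasDerivAt (fun s : ℂ => γ * s) γ t := by
    simpa using (hasDerivAt_id t).const_mul γ
  have hcos : HasDerivAt (fun s => Complex.cos (γ*s))
      (-((4 - E^2 * z^2) * (Complex.sin (γ*t) / γ))) t := by
    refine hlin.ccos.congr_deriv ?_
    rw [← hγsq]
    field_simp
  have hsin : HasDerivAt (fun s => Complex.sin (γ*s) / γ) (Complex.cos (γ*t)) t := by
    refine (hlin.csin.div_const γ).congr_deriv ?_
    field_simp
  simp only [phiZ, xFlow_eq hB ha, yFlow_eq hA hb]
  refine HasDerivAt.prodMk ?_ ?_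
  · refine (((hcos.const_mul (p.1 - a)).const_add a).add
      (hsin.const_mul (2*(p.2 - b) + E*(p.1 - a)*z))).congr_deriv ?_
    rw [hB]
    ring
  · refine (((hcos.const_mul (p.2 - b)).const_add b).sub
      (hsin.const_mul (2*(p.1 - a) + E*(p.2 - b)*z))).congr_deriv ?_
    rw [hA]
    ring

/-- For an entire function `f : ℂ → ℂ`, the maps `ψ_t := φ^z_{f(z)·t}` satisfy:
(i) `ψ_{s+t} = ψ_s ∘ ψ_t` and `ψ_0 = id`;
(ii) `ψ_t` preserves the fiber `{(u,v) : u² + v² + z² + Euvz − Au − Bv − Cz − D = 0}`;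
(iii) writing `ψ_t(x,y) = (x(t), y(t))`, we have `x′(t) = f(z)·(2y(t) + E·x(t)·z − B)` and
`y′(t) = −f(z)·(2x(t) + E·y(t)·z − A)`.
That is, the shear vector field `f(z)·V^z` is complete with flow `φ^z_{f(z)·t}`. -/
theorem shear_field_complete (A B C D E z γ : ℂ) (hE : E ≠ 0)
    (hγsq : γ^2 = 4 - E^2 * z^2) (hγ : γ ≠ 0)
    (f : ℂ → ℂ) (hf : Differentiable ℂ f) :
    (∀ s t : ℂ, ∀ p : ℂ × ℂ,
        psiZ A B E z γ f (s + t) p = psiZ A B E z γ f s (psiZ A B E z γ f t p)) ∧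
    (∀ p : ℂ × ℂ, psiZ A B E z γ f 0 p = p) ∧
    (∀ t : ℂ, ∀ p : ℂ × ℂ,
        p.1^2 + p.2^2 + z^2 + E*p.1*p.2*z - A*p.1 - B*p.2 - C*z - D = 0 →
        (psiZ A B E z γ f t p).1^2 + (psiZ A B E z γ f t p).2^2 + z^2
          + E * (psiZ A B E z γ f t p).1 * (psiZ A B E z γ f t p).2 * z
          - A * (psiZ A B E z γ f t p).1 - B * (psiZ A B E z γ f t p).2 - C*z - D = 0) ∧
    (∀ p : ℂ × ℂ, ∀ t : ℂ,
        HasDerivAt (fun s => (psiZ A B E z γ f s p).1)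
          (f z * (2 * (psiZ A B E z γ f t p).2 + E * (psiZ A B E z γ f t p).1 * z - B)) t ∧
        HasDerivAt (fun s => (psiZ A B E z γ f s p).2)
          (-(f z * (2 * (psiZ A B E z γ f t p).1 + E * (psiZ A B E z γ f t p).2 * z - A))) t) := by
  refine ⟨fun s t p => ?_, fun p => ?_, fun t p hp => phiZ_mem_fiber hγsq hγ (f z * t) hp,
    fun p t => ?_⟩
  · simp only [psiZ, mul_add, phiZ_add hγsq hγ]
  · rw [psiZ, mul_zero, phiZ_zero]
  · have hlin : HasDerivAt (fun s : ℂ => f z * s) (f z) t := by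
      simpa using (hasDerivAt_id t).const_mul (f z)
    have h := (hasDerivAt_phiZ (A := A) (B := B) hγsq hγ p (f z * t)).scomp t hlin
    rw [← mul_neg]
    exact ⟨h.fst, h.snd⟩
end

section
/- Suppose (x,y,z) ∈ ℂ³ satisfies the critical point equations 2x + yz = A, 2y + xz = B, 2z + xy = C, and the Hessian matrix H = [[2, z, y], [z, 2, x], [y, x, 2]] has rank at most 1. Then x² = 4, y² = 4, z² = 4, yz = 2x, xz = 2y, xy = 2z (hence xyz = 8, so the number of negative entries among x, y, z is even), and A = 4x, B = 4y, C = 4z (so A, B, C ∈ {8, −8} with an even number of them equal to −8). If moreover x² + y² + z² + xyz − Ax − By − Cz − D = 0, then D = −28. -/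
/-- All `2 × 2` minors of a matrix of rank at most one vanish. -/
theorem Matrix.mul_apply_eq_mul_apply_of_rank_le_one {m n K : Type*} [Fintype n] [Field K]
    [Finite m] {M : Matrix m n K} (hM : M.rank ≤ 1) (i k : m) (j l : n) :
    M i j * M k l = M i l * M k j := by
  classical
  obtain ⟨v, hv⟩ := finrank_le_one_iff.mp hM
  have col (j : n) : ∃ c : K, ∀ i, M i j = c * (v : m → K) i := by
    obtain ⟨c, hc⟩ := hv ⟨M.mulVecLin (Pi.single j 1), LinearMap.mem_range_self _ _⟩
    refine ⟨c, fun i => ?_⟩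
    have := congrFun (congrArg Subtype.val hc) i
    simpa using this.symm
  obtain ⟨c, hc⟩ := col j
  obtain ⟨d, hd⟩ := col l
  rw [hc, hd, hd, hc]
  ring

/-- Suppose `(x,y,z) ∈ ℂ³` satisfies the critical point equations `2x + yz = A`,
`2y + xz = B`, `2z + xy = C` (for the Markov-type surface with `E = 1`), and the Hessian
matrix `[[2, z, y], [z, 2, x], [y, x, 2]]` has rank at most `1`. Then `x² = 4`, `y² = 4`,
`z² = 4`, `yz = 2x`, `xz = 2y`, `xy = 2z` (hence `xyz = 8`, so the number of negative
entries among `x, y, z` is even), and `A = 4x`, `B = 4y`, `C = 4z` (so `A, B, C ∈ {8, −8}`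
with an even number of them equal to `−8`, equivalently `ABC = 512`). If moreover
`x² + y² + z² + xyz − Ax − By − Cz − D = 0`, then `D = −28`. -/
theorem rank_one_hessian_critical_point (A B C D x y z : ℂ)
    (h1 : 2*x + y*z = A) (h2 : 2*y + x*z = B) (h3 : 2*z + x*y = C)
    (hH : (!![2, z, y; z, 2, x; y, x, 2] : Matrix (Fin 3) (Fin 3) ℂ).rank ≤ 1) :
    x^2 = 4 ∧ y^2 = 4 ∧ z^2 = 4 ∧
    y*z = 2*x ∧ x*z = 2*y ∧ x*y = 2*z ∧
    x*y*z = 8 ∧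
    A = 4*x ∧ B = 4*y ∧ C = 4*z ∧
    (A = 8 ∨ A = -8) ∧ (B = 8 ∨ B = -8) ∧ (C = 8 ∨ C = -8) ∧ A*B*C = 512 ∧
    (x^2 + y^2 + z^2 + x*y*z - A*x - B*y - C*z - D = 0 → D = -28) := by
  have minor := Matrix.mul_apply_eq_mul_apply_of_rank_le_one hH
  have hz : z ^ 2 = 4 := by
    have := minor 0 1 0 1
    simp at this
    linear_combination -this
  have hy : y ^ 2 = 4 := by
    have := minor 0 2 0 2
    simp at this
    linear_combination -this
  have hx : x ^ 2 = 4 := by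
    have := minor 1 2 1 2
    simp at this
    linear_combination -this
  have hyz : y * z = 2 * x := by
    have := minor 0 1 0 2
    simp at this
    linear_combination -this
  have hxz : x * z = 2 * y := by
    have := minor 0 1 1 2
    simp at this
    linear_combination this
  have hxy : x * y = 2 * z := by
    have := minor 1 2 0 2
    simp at this
    linear_combination -this
  have hA : A = 4 * x := by linear_combination -h1 + hyz
  have hB : B = 4 * y := by linear_combination -h2 + hxz
  have hC : C = 4 * z := by linear_combination -h3 + hxy
  have hxyz : x * y * z = 8 := by linear_combination z * hxy + 2 * hz
  have eight_or {a t : ℂ} (ht : t ^ 2 = 4) (ha : a = 4 * t) : a = 8 ∨ a = -8 :=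
    sq_eq_sq_iff_eq_or_eq_neg.mp (by rw [ha]; linear_combination 16 * ht)
  refine ⟨hx, hy, hz, hyz, hxz, hxy, hxyz, hA, hB, hC, eight_or hx hA, eight_or hy hB,
    eight_or hz hC, ?_, fun h => ?_⟩
  · rw [hA, hB, hC]
    linear_combination 64 * hxyz
  · rw [hA, hB, hC] at h
    linear_combination -h - 3 * hx - 3 * hy - 3 * hz + hxyz
end

section
/- (Generation of vector fields on an A_k singularity) For every triple (a, b, c) ∈ ℂ[x,y,z]³ with 2x·a + 2y·b + (k+1)z^k·c ∈ I, there exist polynomials f, g, h ∈ ℂ[x,y,z] and constants c₀, c₁, …, c_{k−1} ∈ ℂ such that each of the three components of (a, b, c) − f·Ṽ^x − g·Ṽ^y − h·Ṽ^z − (c₀ + c₁z + ⋯ + c_{k−1}z^{k−1})·Λ̃ lies in the ideal I. -/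
open MvPolynomial

section Helpers

variable {R : Type*} [CommRing R]

/-- The substitution `x = y = 0` in `R[x,y,z]`. -/
noncomputable def restrictZAxis : MvPolynomial (Fin 3) R →ₐ[R] MvPolynomial (Fin 3) R :=
  aeval ![0, 0, X 2]

lemma exists_eq_add_restrictZAxis (p : MvPolynomial (Fin 3) R) :
    ∃ A B, p = X 0 * A + X 1 * B + restrictZAxis p := by
  induction p using MvPolynomial.induction_on with
  | C r => exact ⟨0, 0, by simp [restrictZAxis]⟩
  | add p q hp hq =>
    obtain ⟨A, B, h⟩ := hp
    obtain ⟨A', B', h'⟩ := hq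
    refine ⟨A + A', B + B', ?_⟩
    rw [map_add]
    linear_combination h + h'
  | mul_X p i hp =>
    obtain ⟨A, B, h⟩ := hp
    fin_cases i
    · exact ⟨p, 0, by simp [restrictZAxis, mul_comm]⟩
    · exact ⟨0, p, by simp [restrictZAxis, mul_comm]⟩
    · refine ⟨A * X 2, B * X 2, ?_⟩
      have hz : restrictZAxis (X 2 : MvPolynomial (Fin 3) R) = X 2 := by simp [restrictZAxis]
      change p * X 2 = _ + restrictZAxis (p * X 2)
      rw [map_mul, hz]
      linear_combination X 2 * h

lemma exists_eq_add_sum_pow {k : ℕ} (hk : 1 ≤ k) (p : MvPolynomial (Fin 3) R) :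
    ∃ (A B W : MvPolynomial (Fin 3) R) (cs : Fin k → R),
      p = X 0 * A + X 1 * B + X 2 ^ k * W + ∑ i : Fin k, C (cs i) * X 2 ^ (i : ℕ) := by
  obtain ⟨k, rfl⟩ := Nat.exists_eq_add_of_le' hk
  induction p using MvPolynomial.induction_on with
  | C r =>
    refine ⟨0, 0, 0, Fin.cons r 0, ?_⟩
    simp [Fin.sum_univ_succ]
  | add p q hp hq =>
    obtain ⟨A, B, W, cs, h⟩ := hp
    obtain ⟨A', B', W', cs', h'⟩ := hq
    refine ⟨A + A', B + B', W + W', cs + cs', ?_⟩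
    simp only [Pi.add_apply, map_add, add_mul, Finset.sum_add_distrib]
    linear_combination h + h'
  | mul_X p i hp =>
    obtain ⟨A, B, W, cs, h⟩ := hp
    fin_cases i
    · exact ⟨p, 0, 0, 0, by simp [mul_comm]⟩
    · exact ⟨0, p, 0, 0, by simp [mul_comm]⟩
    · refine ⟨A * X 2, B * X 2, W * X 2 + C (cs (Fin.last k)),
        Fin.cons 0 fun i => cs i.castSucc, ?_⟩
      change p * X 2 = _
      rw [Fin.sum_univ_castSucc] at h
      rw [Fin.sum_univ_succ]
      simp only [Fin.cons_zero, Fin.cons_succ, map_zero, zero_mul, zero_add, Fin.val_succ,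
        Fin.val_castSucc, Fin.val_last, pow_succ _ (Fin.val _), ← mul_assoc,
        ← Finset.sum_mul] at h ⊢
      linear_combination X 2 * h

/-- Exactness of the Koszul complex of the sequence `x, y, w` in its middle degree. -/
lemma koszul_exact [IsDomain R] {a b c w : MvPolynomial (Fin 3) R} (hw : restrictZAxis w ≠ 0)
    (h : X 0 * a + X 1 * b + w * c = 0) :
    ∃ f g t, a = -(g * w) + t * X 1 ∧ b = f * w - t * X 0 ∧ c = g * X 0 - f * X 1 := by
  have hc : restrictZAxis c = 0 := by
    have h' := congrArg restrictZAxis h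
    simp only [map_add, map_mul, map_zero] at h'
    have hx : restrictZAxis (X 0 : MvPolynomial (Fin 3) R) = 0 := by simp [restrictZAxis]
    have hy : restrictZAxis (X 1 : MvPolynomial (Fin 3) R) = 0 := by simp [restrictZAxis]
    simpa [hx, hy, hw] using h'
  obtain ⟨A, B, hAB⟩ := exists_eq_add_restrictZAxis c
  rw [hc, add_zero] at hAB
  have hxy : X 0 * (a + A * w) + X 1 * (b + B * w) = 0 := by
    rw [hAB] at h
    linear_combination h
  have hdvd : (X 0 : MvPolynomial (Fin 3) R) ∣ X 1 * (b + B * w) :=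
    ⟨-(a + A * w), by linear_combination hxy⟩
  obtain ⟨t, ht⟩ := ((X_prime (i := 0)).dvd_or_dvd hdvd).resolve_left (by simp [X_dvd_X])
  refine ⟨-B, A, -t, ?_, by linear_combination ht, by linear_combination hAB⟩
  have hx0 : (X 0 : MvPolynomial (Fin 3) R) ≠ 0 := X_ne_zero 0
  apply mul_left_cancel₀ hx0
  linear_combination hxy - X 1 * ht

end Helpers

/-- (Generation of vector fields on an `A_k` singularity.)
Let `q = x² + y² + z^{k+1}` and `I = (q)`. A polynomial vector field `(a,b,c)` is tangent
to `{q = 0}` exactly when `2x·a + 2y·b + (k+1)z^k·c ∈ I`. For every such tangential field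
there exist `f, g, h ∈ ℂ[x,y,z]` and constants `c₀, …, c_{k−1} ∈ ℂ` such that each
component of `(a,b,c) − f·Ṽ^x − g·Ṽ^y − h·Ṽ^z − (c₀ + c₁z + ⋯ + c_{k−1}z^{k−1})·Λ̃`
lies in `I`, where `Ṽ^x = (0, (k+1)z^k, −2y)`, `Ṽ^y = (−(k+1)z^k, 0, 2x)`,
`Ṽ^z = (2y, −2x, 0)` and `Λ̃ = ((k+1)x, (k+1)y, 2z)`. -/
theorem Ak_vector_fields_generation (k : ℕ) (hk : 1 ≤ k)
    (a b c : MvPolynomial (Fin 3) ℂ)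
    (htan : 2 * X 0 * a + 2 * X 1 * b + ((k : MvPolynomial (Fin 3) ℂ) + 1) * X 2 ^ k * c ∈
      Ideal.span {X 0 ^ 2 + X 1 ^ 2 + X 2 ^ (k + 1)}) :
    ∃ (f g h : MvPolynomial (Fin 3) ℂ) (cs : Fin k → ℂ),
      (a - f * 0
         - g * (-(((k : MvPolynomial (Fin 3) ℂ) + 1) * X 2 ^ k))
         - h * (2 * X 1)
         - (∑ i : Fin k, MvPolynomial.C (cs i) * X 2 ^ (i : ℕ))
             * (((k : MvPolynomial (Fin 3) ℂ) + 1) * X 0) ∈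
        Ideal.span {X 0 ^ 2 + X 1 ^ 2 + X 2 ^ (k + 1)}) ∧
      (b - f * (((k : MvPolynomial (Fin 3) ℂ) + 1) * X 2 ^ k)
         - g * 0
         - h * (-(2 * X 0))
         - (∑ i : Fin k, MvPolynomial.C (cs i) * X 2 ^ (i : ℕ))
             * (((k : MvPolynomial (Fin 3) ℂ) + 1) * X 1) ∈
        Ideal.span {X 0 ^ 2 + X 1 ^ 2 + X 2 ^ (k + 1)}) ∧
      (c - f * (-(2 * X 1))
         - g * (2 * X 0)
         - h * 0
         - (∑ i : Fin k, MvPolynomial.C (cs i) * X 2 ^ (i : ℕ)) * (2 * X 2) ∈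
        Ideal.span {X 0 ^ 2 + X 1 ^ 2 + X 2 ^ (k + 1)}) := by
  obtain ⟨u, hu⟩ := Ideal.mem_span_singleton'.1 htan
  have hk0 : (k : ℂ) + 1 ≠ 0 := Nat.cast_add_one_ne_zero k
  set n : MvPolynomial (Fin 3) ℂ := (k : MvPolynomial (Fin 3) ℂ) + 1 with hn
  have hnC : n = C ((k : ℂ) + 1) := by simp [hn]
  obtain ⟨r, hr⟩ : ∃ r, n * r = 1 :=
    ⟨C ((k : ℂ) + 1)⁻¹, by rw [hnC, ← C_mul, mul_inv_cancel₀ hk0, C_1]⟩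
  obtain ⟨s, hs⟩ : ∃ s : MvPolynomial (Fin 3) ℂ, 2 * s = 1 :=
    ⟨C 2⁻¹, by rw [← map_ofNat C 2, ← C_mul, mul_inv_cancel₀ (by norm_num), C_1]⟩
  have hw : restrictZAxis (n * X 2 ^ k) ≠ 0 := by
    have hz : restrictZAxis (X 2 : MvPolynomial (Fin 3) ℂ) = X 2 := by simp [restrictZAxis]
    rw [map_mul, map_pow, hz]
    refine mul_ne_zero ?_ (pow_ne_zero _ (X_ne_zero 2))
    rw [hnC]
    simpa [restrictZAxis] using Nat.cast_add_one_ne_zero (R := MvPolynomial (Fin 3) ℂ) k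
  obtain ⟨v, hv⟩ : ∃ v, v = u * r * s := ⟨_, rfl⟩
  have hv' : 2 * n * v = u := by rw [hv]; linear_combination 2 * s * u * hr + u * hs
  have hsyz : X 0 * (2 * (a - v * (n * X 0))) + X 1 * (2 * (b - v * (n * X 1)))
      + n * X 2 ^ k * (c - v * (2 * X 2)) = 0 := by
    linear_combination -hu - (X 0 ^ 2 + X 1 ^ 2 + X 2 ^ (k + 1)) * hv'
  obtain ⟨f, g, t, ha, hb, hc⟩ := koszul_exact hw hsyz
  obtain ⟨A, B, W, cs, hd⟩ := exists_eq_add_sum_pow hk v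
  refine ⟨s * f - X 2 * B + X 1 * W, s * g + X 2 * A - X 0 * W,
    s ^ 2 * t - n * s * X 1 * A + n * s * X 0 * B, cs, ?_, ?_, ?_⟩
  all_goals
    generalize (∑ i : Fin k, C (cs i) * X 2 ^ (i : ℕ)) = P at hd ⊢
    rw [Ideal.mem_span_singleton']
  · refine ⟨n * A, ?_⟩
    linear_combination -s * ha - n * X 0 * hd + (a - v * (n * X 0) + s * t * X 1 - n * X 1 ^ 2 * A + n * X 0 * X 1 * B) * hs
  · refine ⟨n * B, ?_⟩
    linear_combination -s * hb - n * X 1 * hd + (b - v * (n * X 1) - s * t * X 0 + n * X 0 * X 1 * A - n * X 0 ^ 2 * B) * hs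
  · refine ⟨2 * W, ?_⟩
    linear_combination -hc - 2 * X 2 * hd + (g * X 0 - f * X 1) * hs
end

section
/- (Directness on an A_k singularity) If c₀, c₁, …, c_{k−1} ∈ ℂ and f, g, h ∈ ℂ[x,y,z] are such that every component of (c₀ + c₁z + ⋯ + c_{k−1}z^{k−1})·Λ̃ − f·Ṽ^x − g·Ṽ^y − h·Ṽ^z lies in the ideal I, then c₀ = c₁ = ⋯ = c_{k−1} = 0. In particular, for 0 ≤ i ≤ k−1 the vector field z^i·Λ̃ does not lie in the ℂ[x,y,z]-module generated by Ṽ^x, Ṽ^y, Ṽ^z modulo I. -/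
open MvPolynomial

lemma coeff_mul_X_pow_eq_zero {σ R : Type*} [CommSemiring R] (p : MvPolynomial σ R)
    {m : σ →₀ ℕ} {j : σ} {n : ℕ} (h : m j < n) : coeff m (p * X j ^ n) = 0 := by
  classical
  rw [X_pow_eq_monomial, coeff_mul_monomial', if_neg]
  intro hle
  simpa using (hle j).trans_lt h

/-- (Directness on an `A_k` singularity.)
Let `q = x² + y² + z^{k+1}` and `I = (q)`, with tangential fields
`Ṽ^x = (0, (k+1)z^k, −2y)`, `Ṽ^y = (−(k+1)z^k, 0, 2x)`, `Ṽ^z = (2y, −2x, 0)` and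
`Λ̃ = ((k+1)x, (k+1)y, 2z)`. If `c₀, …, c_{k−1} ∈ ℂ` and `f, g, h ∈ ℂ[x,y,z]` are such
that every component of `(c₀ + c₁z + ⋯ + c_{k−1}z^{k−1})·Λ̃ − f·Ṽ^x − g·Ṽ^y − h·Ṽ^z`
lies in `I`, then `c₀ = ⋯ = c_{k−1} = 0`. In particular, for `0 ≤ i ≤ k−1` the field
`z^i·Λ̃` does not lie in the `ℂ[x,y,z]`-module generated by `Ṽ^x, Ṽ^y, Ṽ^z` modulo `I`. -/
theorem Ak_vector_fields_directness (k : ℕ) (hk : 1 ≤ k)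
    (cs : Fin k → ℂ) (f g h : MvPolynomial (Fin 3) ℂ)
    (h1 : (∑ i : Fin k, MvPolynomial.C (cs i) * X 2 ^ (i : ℕ))
            * (((k : MvPolynomial (Fin 3) ℂ) + 1) * X 0)
          - f * 0
          - g * (-(((k : MvPolynomial (Fin 3) ℂ) + 1) * X 2 ^ k))
          - h * (2 * X 1) ∈
        Ideal.span {X 0 ^ 2 + X 1 ^ 2 + X 2 ^ (k + 1)})
    (h2 : (∑ i : Fin k, MvPolynomial.C (cs i) * X 2 ^ (i : ℕ))
            * (((k : MvPolynomial (Fin 3) ℂ) + 1) * X 1)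
          - f * (((k : MvPolynomial (Fin 3) ℂ) + 1) * X 2 ^ k)
          - g * 0
          - h * (-(2 * X 0)) ∈
        Ideal.span {X 0 ^ 2 + X 1 ^ 2 + X 2 ^ (k + 1)})
    (h3 : (∑ i : Fin k, MvPolynomial.C (cs i) * X 2 ^ (i : ℕ)) * (2 * X 2)
          - f * (-(2 * X 1))
          - g * (2 * X 0)
          - h * 0 ∈
        Ideal.span {X 0 ^ 2 + X 1 ^ 2 + X 2 ^ (k + 1)}) :
    ∀ i : Fin k, cs i = 0 := by
  intro i
  obtain ⟨r, hr⟩ := Ideal.mem_span_singleton'.mp h1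
  set m : Fin 3 →₀ ℕ := Finsupp.single 2 (i : ℕ) + Finsupp.single 0 1 with hm
  have hm0 : m 0 = 1 := by simp [hm]
  have hm1 : m 1 = 0 := by simp [hm]
  have hm2 : m 2 = i := by simp [hm]
  have key : C ((k : ℂ) + 1) * ((∑ j : Fin k, C (cs j) * X 2 ^ (j : ℕ)) * X 0)
      = r * X 0 ^ 2 + r * X 1 ^ 2 + r * X 2 ^ (k + 1)
        - (g * ((k : MvPolynomial (Fin 3) ℂ) + 1)) * X 2 ^ k + (h * 2) * X 1 ^ 1 := by
    simp only [map_add, map_natCast, map_one]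
    linear_combination -hr
  have hc := congrArg (coeff m) key
  rw [coeff_add, coeff_sub, coeff_add, coeff_add,
    coeff_mul_X_pow_eq_zero r (by omega : m 0 < 2),
    coeff_mul_X_pow_eq_zero r (by omega : m 1 < 2),
    coeff_mul_X_pow_eq_zero r (by omega : m 2 < k + 1),
    coeff_mul_X_pow_eq_zero _ (by omega : m 2 < k),
    coeff_mul_X_pow_eq_zero _ (by omega : m 1 < 1),
    coeff_C_mul, hm, coeff_mul_X, coeff_sum] at hc
  simpa [coeff_C_mul, coeff_X_pow, (Finsupp.single_injective (2 : Fin 3)).eq_iff, Fin.val_inj,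
    Nat.cast_add_one_ne_zero] using hc
end

section
/- (Generation of vector fields on a D_k singularity) For every triple (a, b, c) ∈ ℂ[x,y,z]³ with (y² + (k−1)x^{k−2})·a + 2xy·b + 2z·c ∈ I, there exist polynomials f, g, h ∈ ℂ[x,y,z], constants c₀, c₁, …, c_{k−2} ∈ ℂ and a constant ε ∈ ℂ such that each of the three components of (a, b, c) − f·V̂^x − g·V̂^y − h·V̂^z − (c₀ + c₁x + ⋯ + c_{k−2}x^{k−2})·Λ̂ − ε·K̂ lies in the ideal I. -/
open MvPolynomial

/-- Setting the variable `X i` to zero changes a polynomial by a multiple of `X i`. -/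
theorem X_dvd_sub_aeval_update_zero {σ R : Type*} [DecidableEq σ] [CommRing R] (i : σ)
    (p : MvPolynomial σ R) :
    (X i : MvPolynomial σ R) ∣ p - aeval (Function.update X i (0 : MvPolynomial σ R)) p := by
  induction p using MvPolynomial.induction_on with
  | C r => simp [MvPolynomial.algebraMap_eq]
  | add p₁ p₂ h₁ h₂ =>
    rw [map_add, add_sub_add_comm]
    exact dvd_add h₁ h₂
  | mul_X p j h =>
    obtain ⟨d, hd⟩ := h
    rw [map_mul, aeval_X]
    rcases eq_or_ne j i with rfl | hj
    · simp
    · rw [Function.update_of_ne hj, ← sub_mul, hd, mul_assoc]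
      exact dvd_mul_right _ _

theorem two_mul_C_half (σ : Type*) : (2 : MvPolynomial σ ℂ) * C (1 / 2) = 1 := by
  rw [← map_ofNat (C : ℂ →+* MvPolynomial σ ℂ) 2, ← map_mul]
  norm_num

/-- First syzygies of the coprime pair `y² + (n+1)xⁿ`, `2xy` are Koszul. -/
theorem Dk_partials_xy_syzygy {n : ℕ} (hn : n ≠ 0) {a b : MvPolynomial (Fin 3) ℂ}
    (hab : (X 1 ^ 2 + ((n + 1 : ℕ) : MvPolynomial (Fin 3) ℂ) * X 0 ^ n) * a
      + 2 * X 0 * X 1 * b = 0) :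
    ∃ h : MvPolynomial (Fin 3) ℂ, a = 2 * X 0 * X 1 * h ∧
      b = -((X 1 ^ 2 + ((n + 1 : ℕ) : MvPolynomial (Fin 3) ℂ) * X 0 ^ n) * h) := by
  set P : MvPolynomial (Fin 3) ℂ := X 1 ^ 2 + ((n + 1 : ℕ) : MvPolynomial (Fin 3) ℂ) * X 0 ^ n
    with hP
  have hx : ¬ (X 0 : MvPolynomial (Fin 3) ℂ) ∣ P := by
    rintro ⟨d, hd⟩
    simpa [hP, hn] using congrArg (eval ![0, 1, 0]) hd
  have hy : ¬ (X 1 : MvPolynomial (Fin 3) ℂ) ∣ P := by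
    rintro ⟨d, hd⟩
    have := congrArg (eval ![1, 0, 0]) hd
    simp [hP] at this
    exact Nat.cast_add_one_ne_zero n this
  have hyx : ¬ (X 1 : MvPolynomial (Fin 3) ℂ) ∣ X 0 := by
    rintro ⟨d, hd⟩
    simpa using congrArg (eval ![1, 0, 0]) hd
  obtain ⟨t, rfl⟩ : X 0 ∣ a := ((X_prime (i := 0)).dvd_or_dvd
    ⟨-(2 * X 1 * b), by linear_combination hab⟩).resolve_left hx
  obtain ⟨u, rfl⟩ : X 1 ∣ t := by
    have : X 1 ∣ X 0 * t := ((X_prime (i := 1)).dvd_or_dvd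
      ⟨-(2 * X 0 * b), by linear_combination hab⟩).resolve_left hy
    exact ((X_prime (i := 1)).dvd_or_dvd this).resolve_left hyx
  have half := two_mul_C_half (Fin 3)
  refine ⟨C (1 / 2) * u, by linear_combination (-X 0 * X 1 * u) * half, ?_⟩
  have h0 : (2 * X 0 * X 1 : MvPolynomial (Fin 3) ℂ) ≠ 0 :=
    mul_ne_zero (mul_ne_zero two_ne_zero (X_ne_zero 0)) (X_ne_zero 1)
  refine mul_left_cancel₀ h0 ?_
  linear_combination hab + (P * X 0 * X 1 * u) * half

/-- First syzygies of the gradient of `xy² + x^{n+1} + z²` are Koszul. -/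
theorem Dk_gradient_syzygy {n : ℕ} (hn : n ≠ 0) {a b c : MvPolynomial (Fin 3) ℂ}
    (habc : (X 1 ^ 2 + ((n + 1 : ℕ) : MvPolynomial (Fin 3) ℂ) * X 0 ^ n) * a
      + 2 * X 0 * X 1 * b + 2 * X 2 * c = 0) :
    ∃ f g h : MvPolynomial (Fin 3) ℂ,
      a = -(2 * X 2 * g) + 2 * X 0 * X 1 * h ∧
      b = 2 * X 2 * f - (X 1 ^ 2 + ((n + 1 : ℕ) : MvPolynomial (Fin 3) ℂ) * X 0 ^ n) * h ∧
      c = -(2 * X 0 * X 1 * f)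
        + (X 1 ^ 2 + ((n + 1 : ℕ) : MvPolynomial (Fin 3) ℂ) * X 0 ^ n) * g := by
  obtain ⟨a₁, ha⟩ := X_dvd_sub_aeval_update_zero 2 a
  obtain ⟨b₁, hb⟩ := X_dvd_sub_aeval_update_zero 2 b
  have h₀ := congrArg (aeval (Function.update X 2 (0 : MvPolynomial (Fin 3) ℂ))) habc
  simp only [map_add, map_mul, map_pow, map_natCast, map_ofNat, map_zero, aeval_X,
    Function.update_self, Function.update_of_ne (show (0 : Fin 3) ≠ 2 by decide),
    Function.update_of_ne (show (1 : Fin 3) ≠ 2 by decide), mul_zero, zero_mul, add_zero] at h₀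
  obtain ⟨h, ha₀, hb₀⟩ := Dk_partials_xy_syzygy hn h₀
  rw [ha₀] at ha
  rw [hb₀] at hb
  have half := two_mul_C_half (Fin 3)
  refine ⟨C (1 / 2) * b₁, -(C (1 / 2) * a₁), h, ?_, ?_, ?_⟩
  · linear_combination ha - X 2 * a₁ * half
  · linear_combination hb - X 2 * b₁ * half
  · have h2 : (2 * X 2 : MvPolynomial (Fin 3) ℂ) ≠ 0 := mul_ne_zero two_ne_zero (X_ne_zero 2)
    refine mul_left_cancel₀ h2 ?_
    linear_combination habc
      - (X 1 ^ 2 + ((n + 1 : ℕ) : MvPolynomial (Fin 3) ℂ) * X 0 ^ n) * ha - 2 * X 0 * X 1 * hb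
      + ((X 1 ^ 2 + ((n + 1 : ℕ) : MvPolynomial (Fin 3) ℂ) * X 0 ^ n) * X 2 * a₁
        + 2 * X 0 * X 1 * X 2 * b₁) * half

/-- Modulo the gradient ideal every polynomial is congruent to one of the form `p(x) + ε y`. -/
theorem Dk_milnor_decomposition (n : ℕ) (s : MvPolynomial (Fin 3) ℂ) :
    ∃ (p : Polynomial ℂ) (ε : ℂ) (u v w : MvPolynomial (Fin 3) ℂ),
      s = Polynomial.aeval (X 0) p + C ε * X 1
        + (X 1 ^ 2 + ((n + 1 : ℕ) : MvPolynomial (Fin 3) ℂ) * X 0 ^ n) * u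
        + 2 * X 0 * X 1 * v + 2 * X 2 * w := by
  have half := two_mul_C_half (Fin 3)
  induction s using MvPolynomial.induction_on with
  | C r => exact ⟨Polynomial.C r, 0, 0, 0, 0, by simp [MvPolynomial.algebraMap_eq]⟩
  | add s₁ s₂ h₁ h₂ =>
    obtain ⟨p₁, ε₁, u₁, v₁, w₁, rfl⟩ := h₁
    obtain ⟨p₂, ε₂, u₂, v₂, w₂, rfl⟩ := h₂
    refine ⟨p₁ + p₂, ε₁ + ε₂, u₁ + u₂, v₁ + v₂, w₁ + w₂, ?_⟩
    rw [map_add, map_add]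
    ring
  | mul_X s j h =>
    obtain ⟨p, ε, u, v, w, rfl⟩ := h
    fin_cases j
    · refine ⟨p * Polynomial.X, 0, u * X 0, v * X 0 + C (1 / 2) * C ε, w * X 0, ?_⟩
      simp only [map_mul, Polynomial.aeval_X, map_zero, Fin.mk_zero]
      linear_combination (-X 0 * X 1 * C ε) * half
    · have hp := congrArg (Polynomial.aeval (X 0 : MvPolynomial (Fin 3) ℂ))
        p.divX_mul_X_add
      simp only [map_add, map_mul, Polynomial.aeval_X, Polynomial.aeval_C,
        MvPolynomial.algebraMap_eq] at hp
      refine ⟨-Polynomial.C (ε * (n + 1 : ℕ)) * Polynomial.X ^ n, p.coeff 0, u * X 1 + C ε,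
        v * X 1 + C (1 / 2) * Polynomial.aeval (X 0) p.divX, w * X 1, ?_⟩
      simp only [map_mul, map_neg, map_pow, Polynomial.aeval_X, Polynomial.aeval_C,
        MvPolynomial.algebraMap_eq, map_natCast, Fin.mk_one]
      linear_combination (-X 1) * hp
        - X 0 * X 1 * Polynomial.aeval (X 0 : MvPolynomial (Fin 3) ℂ) p.divX * half
    · refine ⟨0, 0, u * X 2, v * X 2,
        w * X 2 + C (1 / 2) * (Polynomial.aeval (X 0) p + C ε * X 1), ?_⟩
      simp only [map_zero, Fin.reduceFinMk]
      linear_combination (-X 2 * (Polynomial.aeval (X 0) p + C ε * X 1)) * half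

/-- In `Dk_milnor_decomposition` the polynomial `p` can be taken of degree at most `n`. -/
theorem Dk_milnor_decomposition_sum (n : ℕ) (s : MvPolynomial (Fin 3) ℂ) :
    ∃ (cs : Fin (n + 1) → ℂ) (ε : ℂ) (u v w : MvPolynomial (Fin 3) ℂ),
      s = (∑ i : Fin (n + 1), C (cs i) * X 0 ^ (i : ℕ)) + C ε * X 1
        + (X 1 ^ 2 + ((n + 1 : ℕ) : MvPolynomial (Fin 3) ℂ) * X 0 ^ n) * u
        + 2 * X 0 * X 1 * v + 2 * X 2 * w := by
  obtain ⟨p, ε, u, v, w, rfl⟩ := Dk_milnor_decomposition n s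
  have hm : (Polynomial.X ^ (n + 1) : Polynomial ℂ).Monic := Polynomial.monic_X_pow _
  have hdeg : (p %ₘ Polynomial.X ^ (n + 1)).natDegree < n + 1 := by
    have := Polynomial.natDegree_modByMonic_lt p hm (by
      intro h
      simpa using congrArg Polynomial.natDegree h)
    simpa using this
  have hp := congrArg (Polynomial.aeval (X 0 : MvPolynomial (Fin 3) ℂ))
    (Polynomial.modByMonic_add_div p (Polynomial.X ^ (n + 1)))
  rw [map_add, Polynomial.aeval_eq_sum_range' hdeg, Finset.sum_range] at hp
  simp only [map_mul, map_pow, Polynomial.aeval_X, smul_eq_C_mul] at hp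
  set d := Polynomial.aeval (X 0 : MvPolynomial (Fin 3) ℂ) (p /ₘ Polynomial.X ^ (n + 1))
  have half := two_mul_C_half (Fin 3)
  have hinv : ((n + 1 : ℕ) : MvPolynomial (Fin 3) ℂ) * C ((n + 1 : ℕ) : ℂ)⁻¹ = 1 := by
    rw [← map_natCast (C : ℂ →+* MvPolynomial (Fin 3) ℂ), ← map_mul,
      mul_inv_cancel₀ (Nat.cast_ne_zero.mpr n.succ_ne_zero), map_one]
  refine ⟨fun i => (p %ₘ Polynomial.X ^ (n + 1)).coeff i, ε,
    u + C ((n + 1 : ℕ) : ℂ)⁻¹ * X 0 * d,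
    v - C (1 / 2) * C ((n + 1 : ℕ) : ℂ)⁻¹ * X 1 * d, w, ?_⟩
  linear_combination -hp - X 0 ^ (n + 1) * d * hinv
    + X 0 * X 1 ^ 2 * C ((n + 1 : ℕ) : ℂ)⁻¹ * d * half

/-- (Generation of vector fields on a `D_k` singularity.)
Let `q = xy² + x^{k−1} + z²` (`k ≥ 4`) and `I = (q)`. A polynomial vector field `(a,b,c)`
is tangent to `{q = 0}` exactly when `(y² + (k−1)x^{k−2})·a + 2xy·b + 2z·c ∈ I`. For every
such tangential field there exist `f, g, h ∈ ℂ[x,y,z]`, constants `c₀, …, c_{k−2} ∈ ℂ` and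
`ε ∈ ℂ` such that each component of
`(a,b,c) − f·V̂^x − g·V̂^y − h·V̂^z − (c₀ + c₁x + ⋯ + c_{k−2}x^{k−2})·Λ̂ − ε·K̂` lies in `I`,
where `V̂^x = (0, 2z, −2xy)`, `V̂^y = (−2z, 0, y² + (k−1)x^{k−2})`,
`V̂^z = (2xy, −(y² + (k−1)x^{k−2}), 0)`, `Λ̂ = (2x, (k−2)y, (k−1)z)` and
`K̂ = (0, y² + x^{k−2}, yz)`. -/
theorem Dk_vector_fields_generation (k : ℕ) (hk : 4 ≤ k)
    (a b c : MvPolynomial (Fin 3) ℂ)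
    (htan : (X 1 ^ 2 + ((k - 1 : ℕ) : MvPolynomial (Fin 3) ℂ) * X 0 ^ (k - 2)) * a
        + 2 * X 0 * X 1 * b + 2 * X 2 * c ∈
      Ideal.span {X 0 * X 1 ^ 2 + X 0 ^ (k - 1) + X 2 ^ 2}) :
    ∃ (f g h : MvPolynomial (Fin 3) ℂ) (cs : Fin (k - 1) → ℂ) (ε : ℂ),
      (a - f * 0
         - g * (-(2 * X 2))
         - h * (2 * X 0 * X 1)
         - (∑ i : Fin (k - 1), MvPolynomial.C (cs i) * X 0 ^ (i : ℕ)) * (2 * X 0)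
         - MvPolynomial.C ε * 0 ∈
        Ideal.span {X 0 * X 1 ^ 2 + X 0 ^ (k - 1) + X 2 ^ 2}) ∧
      (b - f * (2 * X 2)
         - g * 0
         - h * (-(X 1 ^ 2 + ((k - 1 : ℕ) : MvPolynomial (Fin 3) ℂ) * X 0 ^ (k - 2)))
         - (∑ i : Fin (k - 1), MvPolynomial.C (cs i) * X 0 ^ (i : ℕ))
             * (((k - 2 : ℕ) : MvPolynomial (Fin 3) ℂ) * X 1)
         - MvPolynomial.C ε * (X 1 ^ 2 + X 0 ^ (k - 2)) ∈
        Ideal.span {X 0 * X 1 ^ 2 + X 0 ^ (k - 1) + X 2 ^ 2}) ∧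
      (c - f * (-(2 * X 0 * X 1))
         - g * (X 1 ^ 2 + ((k - 1 : ℕ) : MvPolynomial (Fin 3) ℂ) * X 0 ^ (k - 2))
         - h * 0
         - (∑ i : Fin (k - 1), MvPolynomial.C (cs i) * X 0 ^ (i : ℕ))
             * (((k - 1 : ℕ) : MvPolynomial (Fin 3) ℂ) * X 2)
         - MvPolynomial.C ε * (X 1 * X 2) ∈
        Ideal.span {X 0 * X 1 ^ 2 + X 0 ^ (k - 1) + X 2 ^ 2}) := by
  obtain ⟨n, rfl⟩ : ∃ n, k = n + 2 := ⟨k - 2, by omega⟩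
  have hn : n ≠ 0 := by omega
  simp only [Nat.add_sub_cancel, show n + 2 - 1 = n + 1 from rfl] at htan ⊢
  obtain ⟨s, hs⟩ := Ideal.mem_span_singleton'.mp htan
  obtain ⟨cs, ε, u, v, w, hdec⟩ :=
    Dk_milnor_decomposition_sum n (C (2 * ((n + 1 : ℕ) : ℂ))⁻¹ * s)
  have hinv : (2 * ((n + 1 : ℕ) : MvPolynomial (Fin 3) ℂ)) * C (2 * ((n + 1 : ℕ) : ℂ))⁻¹ = 1 := by
    rw [← map_natCast (C : ℂ →+* MvPolynomial (Fin 3) ℂ),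
      ← map_ofNat (C : ℂ →+* MvPolynomial (Fin 3) ℂ) 2, ← map_mul, ← map_mul,
      mul_inv_cancel₀ (mul_ne_zero two_ne_zero (Nat.cast_ne_zero.mpr n.succ_ne_zero)), map_one]
  set S : MvPolynomial (Fin 3) ℂ := ∑ i : Fin (n + 1), C (cs i) * X 0 ^ (i : ℕ)
  set q : MvPolynomial (Fin 3) ℂ := X 0 * X 1 ^ 2 + X 0 ^ (n + 1) + X 2 ^ 2 with hq
  set N : MvPolynomial (Fin 3) ℂ := ((n + 1 : ℕ) : MvPolynomial (Fin 3) ℂ) with hN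
  have hNn : N = (n : MvPolynomial (Fin 3) ℂ) + 1 := by rw [hN]; push_cast; rfl
  obtain ⟨f, g, h, ha, hb, hc⟩ := Dk_gradient_syzygy hn
    (a := a - S * (2 * X 0) - 2 * N * u * q)
    (b := b - S * ((n : MvPolynomial (Fin 3) ℂ) * X 1)
      - C (ε * (n + 1 : ℕ)) * (X 1 ^ 2 + X 0 ^ n) - 2 * N * v * q)
    (c := c - S * (N * X 2) - C (ε * (n + 1 : ℕ)) * (X 1 * X 2) - 2 * N * w * q) (by
      rw [← hN, map_mul, map_natCast, ← hN]
      linear_combination -hs + 2 * N * q * hdec - s * q * hinv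
        + 2 * S * (X 0 * X 1 ^ 2) * hNn + 2 * N * (S + C ε * X 1) * hq)
  have hS : ∑ i : Fin (n + 2 - 1), C (cs i) * X 0 ^ (i : ℕ) = S := rfl
  refine ⟨f, g, h, cs, ε * (n + 1 : ℕ), ?_, ?_, ?_⟩ <;> rw [Ideal.mem_span_singleton', hS]
  · exact ⟨2 * N * u, by linear_combination -ha⟩
  · exact ⟨2 * N * v, by linear_combination -hb⟩
  · exact ⟨2 * N * w, by linear_combination -hc⟩
end

section
/- (Directness on a D_k singularity) If c₀, c₁, …, c_{k−2} ∈ ℂ, ε ∈ ℂ and f, g, h ∈ ℂ[x,y,z] are such that every component of (c₀ + c₁x + ⋯ + c_{k−2}x^{k−2})·Λ̂ + ε·K̂ − f·V̂^x − g·V̂^y − h·V̂^z lies in the ideal I, then c₀ = c₁ = ⋯ = c_{k−2} = 0 and ε = 0. In particular, none of the fields x^i·Λ̂ (0 ≤ i ≤ k−2) and K̂ lies in the ℂ[x,y,z]-module generated by V̂^x, V̂^y, V̂^z modulo I. -/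
open MvPolynomial

/-- The restriction to `z = 0` of the tangency relations, in `ℂ[x][y]`, already forces the
coefficients `P` (of the Euler field) and `ε` to vanish when `P` has degree at most `n`. -/
theorem eq_zero_of_restrict_z_eq_zero {n : ℕ} (hn : 0 < n) {P : Polynomial ℂ}
    (hP : P.degree < (n + 1 : ℕ)) {ε : ℂ} {H A B : Polynomial (Polynomial ℂ)}
    (h1 : Polynomial.C P * (2 * Polynomial.C Polynomial.X)
        - H * (2 * Polynomial.C Polynomial.X * Polynomial.X)
      = (Polynomial.C Polynomial.X * Polynomial.X ^ 2
        + Polynomial.C Polynomial.X ^ (n + 1)) * A)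
    (h2 : Polynomial.C P * ((n : Polynomial (Polynomial ℂ)) * Polynomial.X)
        + Polynomial.C (Polynomial.C ε) * (Polynomial.X ^ 2 + Polynomial.C Polynomial.X ^ n)
        + H * (Polynomial.X ^ 2 + ((n : Polynomial (Polynomial ℂ)) + 1)
          * Polynomial.C Polynomial.X ^ n)
      = (Polynomial.C Polynomial.X * Polynomial.X ^ 2
        + Polynomial.C Polynomial.X ^ (n + 1)) * B) :
    P = 0 ∧ ε = 0 := by
  set x : Polynomial (Polynomial ℂ) := Polynomial.C Polynomial.X with hx
  set y : Polynomial (Polynomial ℂ) := Polynomial.X with hy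
  have hx0 : x ≠ 0 := Polynomial.C_ne_zero.mpr Polynomial.X_ne_zero
  have hD0 : y ^ 2 + x ^ n ≠ 0 := by
    intro h
    have := congrArg (Polynomial.eval 0) h
    simp [hx, hy] at this
  have e1 : 2 * Polynomial.C P - 2 * y * H = (y ^ 2 + x ^ n) * A := by
    apply mul_left_cancel₀ hx0
    linear_combination h1
  have e2 : 2 * ((n : Polynomial (Polynomial ℂ)) + 1) * Polynomial.C P
      + 2 * Polynomial.C (Polynomial.C ε) * y
      = A * (y ^ 2 + ((n : Polynomial (Polynomial ℂ)) + 1) * x ^ n) + 2 * x * y * B := by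
    apply mul_left_cancel₀ hD0
    linear_combination 2 * y * h2 + (y ^ 2 + ((n : Polynomial (Polynomial ℂ)) + 1) * x ^ n) * e1
  have e3 : 2 * P = Polynomial.X ^ n * A.eval 0 := by
    simpa [hx, hy] using congrArg (Polynomial.eval 0) e1
  have e4 := congrArg (Polynomial.map (Polynomial.evalRingHom (0 : ℂ))) e2
  simp [hx, hy, hn.ne'] at e4
  set a := Polynomial.map (Polynomial.evalRingHom (0 : ℂ)) A with ha
  have hc0 : P.eval 0 = 0 := by
    have := congrArg (Polynomial.eval 0) e3
    simpa [hn.ne'] using this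
  rw [hc0] at e4
  have e5 : Polynomial.C (2 * ε) = a * Polynomial.X := by
    apply mul_right_cancel₀ (Polynomial.X_ne_zero (R := ℂ))
    rw [Polynomial.C_mul, Polynomial.C_ofNat]
    rw [Polynomial.C_0] at e4
    linear_combination e4
  have hε : ε = 0 := by
    simpa using congrArg (Polynomial.eval 0) e5
  have ha0 : a = 0 := by
    simpa [hε] using e5
  have hA : Polynomial.X ∣ A.eval 0 := by
    rw [Polynomial.X_dvd_iff, ← Polynomial.coeff_zero_eq_eval_zero]
    have := congrArg (Polynomial.coeff · 0) ha0
    simpa [ha, Polynomial.coeff_zero_eq_eval_zero] using this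
  obtain ⟨r, hr⟩ := hA
  refine ⟨Polynomial.eq_zero_of_dvd_of_degree_lt (p := Polynomial.X ^ (n + 1))
    ⟨Polynomial.C 2⁻¹ * r, ?_⟩ (by simpa using hP), hε⟩
  have h2C : (Polynomial.C (2⁻¹ : ℂ)) * 2 = 1 := by
    rw [← Polynomial.C_ofNat, ← Polynomial.C_mul]
    simp
  rw [hr] at e3
  linear_combination Polynomial.C (2⁻¹ : ℂ) * e3 - P * h2C

/-- (Directness on a `D_k` singularity.)
Let `q = xy² + x^{k−1} + z²` (`k ≥ 4`) and `I = (q)`, with tangential fields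
`V̂^x = (0, 2z, −2xy)`, `V̂^y = (−2z, 0, y² + (k−1)x^{k−2})`,
`V̂^z = (2xy, −(y² + (k−1)x^{k−2}), 0)`, `Λ̂ = (2x, (k−2)y, (k−1)z)` and
`K̂ = (0, y² + x^{k−2}, yz)`. If `c₀, …, c_{k−2}, ε ∈ ℂ` and `f, g, h ∈ ℂ[x,y,z]` are such
that every component of
`(c₀ + c₁x + ⋯ + c_{k−2}x^{k−2})·Λ̂ + ε·K̂ − f·V̂^x − g·V̂^y − h·V̂^z` lies in `I`, then
`c₀ = ⋯ = c_{k−2} = 0` and `ε = 0`. In particular, none of the fields `x^i·Λ̂`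
(`0 ≤ i ≤ k−2`) and `K̂` lies in the `ℂ[x,y,z]`-module generated by `V̂^x, V̂^y, V̂^z`
modulo `I`. -/
theorem Dk_vector_fields_directness (k : ℕ) (hk : 4 ≤ k)
    (cs : Fin (k - 1) → ℂ) (ε : ℂ) (f g h : MvPolynomial (Fin 3) ℂ)
    (h1 : (∑ i : Fin (k - 1), MvPolynomial.C (cs i) * X 0 ^ (i : ℕ)) * (2 * X 0)
          + MvPolynomial.C ε * 0
          - f * 0
          - g * (-(2 * X 2))
          - h * (2 * X 0 * X 1) ∈
        Ideal.span {X 0 * X 1 ^ 2 + X 0 ^ (k - 1) + X 2 ^ 2})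
    (h2 : (∑ i : Fin (k - 1), MvPolynomial.C (cs i) * X 0 ^ (i : ℕ))
            * (((k - 2 : ℕ) : MvPolynomial (Fin 3) ℂ) * X 1)
          + MvPolynomial.C ε * (X 1 ^ 2 + X 0 ^ (k - 2))
          - f * (2 * X 2)
          - g * 0
          - h * (-(X 1 ^ 2 + ((k - 1 : ℕ) : MvPolynomial (Fin 3) ℂ) * X 0 ^ (k - 2))) ∈
        Ideal.span {X 0 * X 1 ^ 2 + X 0 ^ (k - 1) + X 2 ^ 2})
    (h3 : (∑ i : Fin (k - 1), MvPolynomial.C (cs i) * X 0 ^ (i : ℕ))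
            * (((k - 1 : ℕ) : MvPolynomial (Fin 3) ℂ) * X 2)
          + MvPolynomial.C ε * (X 1 * X 2)
          - f * (-(2 * X 0 * X 1))
          - g * (X 1 ^ 2 + ((k - 1 : ℕ) : MvPolynomial (Fin 3) ℂ) * X 0 ^ (k - 2))
          - h * 0 ∈
        Ideal.span {X 0 * X 1 ^ 2 + X 0 ^ (k - 1) + X 2 ^ 2}) :
    (∀ i : Fin (k - 1), cs i = 0) ∧ ε = 0 := by
  obtain ⟨A, hA⟩ := Ideal.mem_span_singleton'.mp h1
  obtain ⟨B, hB⟩ := Ideal.mem_span_singleton'.mp h2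
  set P : Polynomial ℂ := ∑ i : Fin (k - 1), Polynomial.C (cs i) * Polynomial.X ^ (i : ℕ) with hP
  have hk1 : k - 1 = k - 2 + 1 := by omega
  let φ : MvPolynomial (Fin 3) ℂ →ₐ[ℂ] Polynomial (Polynomial ℂ) :=
    aeval ![Polynomial.C Polynomial.X, Polynomial.X, 0]
  have hφ0 : φ (X 0) = Polynomial.C Polynomial.X := by simp [φ]
  have hφ1 : φ (X 1) = Polynomial.X := by simp [φ]
  have hφ2 : φ (X 2) = 0 := by simp [φ]
  have hφC (c : ℂ) : φ (C c) = Polynomial.C (Polynomial.C c) := by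
    simp [φ, Polynomial.algebraMap_apply]
  have hφP : φ (∑ i : Fin (k - 1), C (cs i) * X 0 ^ (i : ℕ)) = Polynomial.C P := by
    simp [hP, hφ0, hφC]
  have hA' := congrArg φ hA
  have hB' := congrArg φ hB
  have hcast : ((k - 1 : ℕ) : Polynomial (Polynomial ℂ)) = ((k - 2 : ℕ) : _) + 1 := by
    rw [hk1]
    push_cast
    rfl
  simp only [map_add, map_sub, map_mul, map_neg, map_pow, map_natCast, map_ofNat, map_zero,
    hφ0, hφ1, hφ2, hφC, hφP, hcast] at hA' hB'
  have hdeg : P.degree < (k - 2 + 1 : ℕ) := by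
    rw [← hk1]
    exact Polynomial.degree_sum_fin_lt cs
  have hpow : (Polynomial.C Polynomial.X : Polynomial (Polynomial ℂ)) ^ (k - 1)
      = Polynomial.C Polynomial.X ^ (k - 2 + 1) := by rw [hk1]
  rw [hpow] at hA' hB'
  obtain ⟨hP0, hε⟩ := eq_zero_of_restrict_z_eq_zero (by omega) hdeg (ε := ε) (H := φ h)
    (A := φ A) (B := φ B) (by linear_combination -hA') (by linear_combination -hB')
  refine ⟨fun i => ?_, hε⟩
  have hi := congrArg (Polynomial.coeff · (i : ℕ)) hP0
  simpa [hP, Polynomial.finsetSum_coeff, Polynomial.coeff_X_pow, Fin.val_inj] using hi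
end

section
/- The following hold: (1) X + iy ≠ 0 and X − iy ≠ 0; (2) x + iY ≠ 0 and x − iY ≠ 0; (3) (ix − Y)·(iy − X) ≠ (X + iy)·(ix + Y), i.e. (ix − Y)/(ix + Y) ≠ (X + iy)/(iy − X), where i denotes the imaginary unit. -/
open Complex

/-- In the coordinate `X = (2x − 3yz)/γ` the Markov equation reads `X² + y² = −4z²/γ²`. -/
lemma markov_rescaled_mul_conj {x y z γ : ℂ} (hM : x^2 + y^2 + z^2 = 3*x*y*z) (h0 : γ ≠ 0)
    (hγ : γ^2 = 4 - 9*z^2) :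
    ((2*x - 3*y*z)/γ + I*y) * ((2*x - 3*y*z)/γ - I*y) = -4*z^2/γ^2 := by
  field_simp
  linear_combination 4*hM + y^2*hγ - y^2*γ^2*I_sq

lemma markov_rescaled_ne_zero {x y z γ : ℂ} (hM : x^2 + y^2 + z^2 = 3*x*y*z) (hz : z ≠ 0)
    (h0 : γ ≠ 0) (hγ : γ^2 = 4 - 9*z^2) :
    (2*x - 3*y*z)/γ + I*y ≠ 0 ∧ (2*x - 3*y*z)/γ - I*y ≠ 0 := by
  rw [← mul_ne_zero_iff, markov_rescaled_mul_conj hM h0 hγ]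
  simp [hz, h0]

/-- Let `(x,y,z)` satisfy the Markov equation `x² + y² + z² = 3xyz` with `z ≠ 0` and
`4 − 9z² ≠ 0`, let `γ² = 4 − 9z²`, and set `X = (2x − 3yz)/γ`, `Y = (2y − 3xz)/γ`. Then
(1) `X ± iy ≠ 0`; (2) `x ± iY ≠ 0`; and
(3) `(ix − Y)/(ix + Y) ≠ (X + iy)/(iy − X)`, stated multiplicatively as
`(ix − Y)·(iy − X) ≠ (X + iy)·(ix + Y)`. -/
theorem markov_nonvanishing_conditions (x y z γ : ℂ)
    (hM : x^2 + y^2 + z^2 = 3*x*y*z) (hz : z ≠ 0) (hz2 : 4 - 9*z^2 ≠ 0)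
    (hγ : γ^2 = 4 - 9*z^2) :
    ((2*x - 3*y*z)/γ + I*y ≠ 0) ∧ ((2*x - 3*y*z)/γ - I*y ≠ 0) ∧
    (x + I*((2*y - 3*x*z)/γ) ≠ 0) ∧ (x - I*((2*y - 3*x*z)/γ) ≠ 0) ∧
    ((I*x - (2*y - 3*x*z)/γ) * (I*y - (2*x - 3*y*z)/γ)
      ≠ ((2*x - 3*y*z)/γ + I*y) * (I*x + (2*y - 3*x*z)/γ)) := by
  have h0 : γ ≠ 0 := by
    rintro rfl
    exact hz2 (by simpa using hγ.symm)
  have hX := markov_rescaled_ne_zero hM hz h0 hγ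
  have hY := markov_rescaled_ne_zero (x := y) (y := x) (by linear_combination hM) hz h0 hγ
  refine ⟨hX.1, hX.2, fun h => hY.2 ?_, fun h => hY.1 ?_, fun h => ?_⟩
  · linear_combination -I*h + (2*y - 3*x*z)/γ*I_sq
  · linear_combination I*h + (2*y - 3*x*z)/γ*I_sq
  · have hsum : x*((2*x - 3*y*z)/γ) + y*((2*y - 3*x*z)/γ) = -2*z^2/γ := by
      field_simp
      linear_combination 2*hM
    have hdiff : -2*I*(x*((2*x - 3*y*z)/γ) + y*((2*y - 3*x*z)/γ)) = 0 := by
      linear_combination h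
    rw [hsum] at hdiff
    simp [hz, h0] at hdiff
end

section
/- The map ℂ ∋ t ↦ φ^z_t(x,y) is surjective onto the fiber F_z: for every (u, v) ∈ ℂ² with u² + v² + z² = 3uvz there exists t ∈ ℂ such that x·cos(γt) + (2y − 3xz)·sin(γt)/γ = u and y·cos(γt) − (2x − 3yz)·sin(γt)/γ = v. -/
theorem exists_cos_eq_and_sin_eq {c s : ℂ} (h : c ^ 2 + s ^ 2 = 1) :
    ∃ w : ℂ, Complex.cos w = c ∧ Complex.sin w = s := by
  obtain ⟨w, rfl⟩ := Complex.cos_surjective c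
  have hs : Complex.sin w ^ 2 = s ^ 2 := by
    linear_combination Complex.sin_sq_add_cos_sq w - h
  rcases sq_eq_sq_iff_eq_or_eq_neg.mp hs with hw | hw
  · exact ⟨w, rfl, hw⟩
  · exact ⟨-w, Complex.cos_neg w, by rw [Complex.sin_neg, hw, neg_neg]⟩

/-- Let `(x,y,z)` satisfy the Markov equation `x² + y² + z² = 3xyz` with `z ≠ 0` and
`4 − 9z² ≠ 0`, and let `γ² = 4 − 9z²`. Then the flow map `t ↦ φ^z_t(x,y)`,
`φ^z_t(x,y) = (x·cos(γt) + (2y − 3xz)·sin(γt)/γ, y·cos(γt) − (2x − 3yz)·sin(γt)/γ)`,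
is surjective onto the fiber `F_z = {(u,v) ∈ ℂ² : u² + v² + z² = 3uvz}`. -/
theorem flow_map_surjective_onto_fiber (x y z γ : ℂ)
    (hM : x^2 + y^2 + z^2 = 3*x*y*z) (hz : z ≠ 0) (hz2 : 4 - 9*z^2 ≠ 0)
    (hγ : γ^2 = 4 - 9*z^2) :
    ∀ u v : ℂ, u^2 + v^2 + z^2 = 3*u*v*z →
      ∃ t : ℂ,
        x * Complex.cos (γ*t) + (2*y - 3*x*z) * Complex.sin (γ*t) / γ = u ∧
        y * Complex.cos (γ*t) - (2*x - 3*y*z) * Complex.sin (γ*t) / γ = v := by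
  intro u v huv
  have hγ0 : γ ≠ 0 := by
    rintro rfl
    exact hz2 (by linear_combination -hγ)
  obtain ⟨w, hc, hs⟩ := exists_cos_eq_and_sin_eq
    (c := -(u * (2*x - 3*y*z) + v * (2*y - 3*x*z)) / (2*z^2))
    (s := γ * (x*v - y*u) / (2*z^2)) (by
      field_simp
      linear_combination 4 * (u^2 + v^2 - 3*u*v*z) * hM - 4 * z^2 * huv + (x*v - y*u)^2 * hγ)
  refine ⟨w / γ, ?_⟩
  rw [mul_div_cancel₀ w hγ0, hc, hs]
  constructor
  · field_simp
    linear_combination -2 * u * hM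
  · field_simp
    linear_combination -2 * v * hM
end

section
/- For every (u, v) ∈ ℂ² with u² + v² + z² = 3uvz there exists T ∈ ℂ with T ≠ 0 satisfying simultaneously the two quadratic equations (ix + Y)·T² − 2iu·T + (ix − Y) = 0 and (iy − X)·T² − 2iv·T + (X + iy) = 0, where i denotes the imaginary unit. -/
open Complex

/-- Let `(x,y,z)` satisfy the Markov equation `x² + y² + z² = 3xyz` with `z ≠ 0` and
`4 − 9z² ≠ 0`, let `γ² = 4 − 9z²`, and set `X = (2x − 3yz)/γ`, `Y = (2y − 3xz)/γ`. Then
for every `(u,v) ∈ ℂ²` with `u² + v² + z² = 3uvz` there exists `T ≠ 0` satisfying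
simultaneously the two quadratic equations `(ix + Y)T² − 2iuT + (ix − Y) = 0` and
`(iy − X)T² − 2ivT + (X + iy) = 0`. (Via `T = exp(iγt)` this is equivalent to the
surjectivity of the flow map `t ↦ φ^z_t(x,y)` onto the fiber.) -/
theorem quadratic_system_solvable (x y z γ : ℂ)
    (hM : x^2 + y^2 + z^2 = 3*x*y*z) (hz : z ≠ 0) (hz2 : 4 - 9*z^2 ≠ 0)
    (hγ : γ^2 = 4 - 9*z^2) :
    ∀ u v : ℂ, u^2 + v^2 + z^2 = 3*u*v*z →
      ∃ T : ℂ, T ≠ 0 ∧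
        (I*x + (2*y - 3*x*z)/γ) * T^2 - 2*I*u*T + (I*x - (2*y - 3*x*z)/γ) = 0 ∧
        (I*y - (2*x - 3*y*z)/γ) * T^2 - 2*I*v*T + ((2*x - 3*y*z)/γ + I*y) = 0 := by
  intro u v huv
  have hγ0 : γ ≠ 0 := by
    rintro rfl
    exact hz2 (by rw [← hγ]; ring)
  have hI : I^2 = -1 := I_sq
  have factor (s t : ℂ) (h : s^2 + t^2 + z^2 = 3*s*t*z) :
      (s - (3*z + I*γ)/2*t) * (s - (3*z - I*γ)/2*t) = -z^2 := by
    linear_combination h - γ^2*t^2/4*hI + t^2/4*hγ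
  have hz2' : -z^2 ≠ 0 := neg_ne_zero.mpr (pow_ne_zero 2 hz)
  have hxy := factor x y hM
  have huv' := factor u v huv
  have hp := left_ne_zero_of_mul (hxy ▸ hz2')
  have ha := left_ne_zero_of_mul (huv' ▸ hz2')
  obtain ⟨T, hT⟩ : ∃ T, (x - (3*z + I*γ)/2*y) * T = u - (3*z + I*γ)/2*v :=
    ⟨_, mul_div_cancel₀ _ hp⟩
  have hT' : (u - (3*z - I*γ)/2*v) * T = x - (3*z - I*γ)/2*y := by
    apply mul_left_cancel₀ hp
    linear_combination (u - (3*z - I*γ)/2*v) * hT + huv' - hxy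
  refine ⟨T, right_ne_zero_of_mul (hT ▸ ha), ?_, ?_⟩
  · field_simp
    linear_combination -(3*z - I*γ)*T*hT - (3*z + I*γ)*hT'
      + (T^2 - 1)*y/2*(γ^2*hI - hγ)
  · field_simp
    linear_combination -2*T*hT - 2*hT'
end

section
/- For all compact subsets K and L of the fiber F_z there exists a nonempty open set U ⊆ ℂ such that for every t ∈ U, every (x, y) ∈ K and every (u, v) ∈ L: the first coordinate of φ^z_t(x,y) is different from u, and the second coordinate of φ^z_t(x,y) is different from v. (Equivalently, φ^z_t(K) avoids both the preimage under the first-coordinate projection of the first coordinates of L and the preimage under the second-coordinate projection of the second coordinates of L.) -/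
open Complex

/-- The fiber `F_z = {(x,y) ∈ ℂ² : x² + y² + z² = 3xyz}` of the Markov surface. -/
def markovFiber (z : ℂ) : Set (ℂ × ℂ) :=
  {p : ℂ × ℂ | p.1^2 + p.2^2 + z^2 = 3 * p.1 * p.2 * z}

/-- The time-`t` flow `φ^z_t` of the vector field `V^z` on the fiber of the Markov
surface. -/
noncomputable def markovFlowZ (z γ t : ℂ) (p : ℂ × ℂ) : ℂ × ℂ :=
  (p.1 * Complex.cos (γ*t) + (2*p.2 - 3*p.1*z) * Complex.sin (γ*t) / γ,
   p.2 * Complex.cos (γ*t) - (2*p.1 - 3*p.2*z) * Complex.sin (γ*t) / γ)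

theorem norm_exp_le_of_cos_add_sin_eq {z γ a b u s : ℂ} {C : ℝ} (hγ : γ ≠ 0)
    (hab : b ^ 2 + γ ^ 2 * a ^ 2 = -4 * z ^ 2) (hC : ‖γ * a + I * b‖ ≤ C)
    (hu : ‖2 * γ * u‖ ≤ C) (hs : 1 ≤ ‖exp (s * I)‖)
    (h : a * cos s + b * sin s / γ = u) :
    4 * ‖z‖ ^ 2 * ‖exp (s * I)‖ ≤ 2 * C ^ 2 := by
  have hw : exp (s * I) ≠ 0 := exp_ne_zero _
  have hinv : exp (-s * I) = (exp (s * I))⁻¹ := by rw [neg_mul, exp_neg]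
  rw [cos, sin, hinv] at h
  generalize exp (s * I) = w at *
  have key : -4 * z ^ 2 * w = (γ * a + I * b) * (2 * γ * u - (γ * a + I * b) * w⁻¹) := by
    have h2 : 2 * γ * u = (γ * a - I * b) * w + (γ * a + I * b) * w⁻¹ := by
      rw [← h]
      field_simp
      ring
    rw [h2, ← hab]
    linear_combination b ^ 2 * w * I_sq
  have hC0 : 0 ≤ C := (norm_nonneg _).trans hC
  have hinv_le : ‖w⁻¹‖ ≤ 1 := by
    rw [norm_inv]
    exact inv_le_one_of_one_le₀ hs
  calc 4 * ‖z‖ ^ 2 * ‖w‖ = ‖-4 * z ^ 2 * w‖ := by simp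
    _ = ‖γ * a + I * b‖ * ‖2 * γ * u - (γ * a + I * b) * w⁻¹‖ := by rw [key, norm_mul]
    _ ≤ C * (C + C * 1) := by
      gcongr
      refine (norm_sub_le _ _).trans (add_le_add hu ?_)
      rw [norm_mul]
      gcongr
    _ = 2 * C ^ 2 := by ring

/-- For `z ≠ 0` with `4 − 9z² ≠ 0` and any two compact subsets `K, L` of the fiber `F_z`,
there is a nonempty open set `U ⊆ ℂ` such that for every `t ∈ U` the set `φ^z_t(K)` avoids
both the preimage under the first-coordinate projection of the first coordinates of `L`
and the preimage under the second-coordinate projection of the second coordinates of `L`: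
for all `(x,y) ∈ K` and `(u,v) ∈ L`, the first coordinate of `φ^z_t(x,y)` differs from `u`
and its second coordinate differs from `v`. -/
theorem flow_avoids_coordinate_preimages (z γ : ℂ) (hz : z ≠ 0)
    (hz2 : 4 - 9*z^2 ≠ 0) (hγ : γ^2 = 4 - 9*z^2)
    (K L : Set (ℂ × ℂ)) (hKc : IsCompact K) (hLc : IsCompact L)
    (hK : K ⊆ markovFiber z) (hL : L ⊆ markovFiber z) :
    ∃ U : Set ℂ, U.Nonempty ∧ IsOpen U ∧
      ∀ t ∈ U, ∀ p ∈ K, ∀ q ∈ L,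
        (markovFlowZ z γ t p).1 ≠ q.1 ∧ (markovFlowZ z γ t p).2 ≠ q.2 := by
  have hγ0 : γ ≠ 0 := by
    rintro rfl
    exact hz2 (by rw [← hγ]; simp)
  obtain ⟨A, hA⟩ := hKc.exists_bound_of_continuousOn
    (f := fun p : ℂ × ℂ => γ * p.1 + I * (2 * p.2 - 3 * p.1 * z)) (by fun_prop)
  obtain ⟨B, hB⟩ := hKc.exists_bound_of_continuousOn
    (f := fun p : ℂ × ℂ => γ * p.2 + I * (-(2 * p.1 - 3 * p.2 * z))) (by fun_prop)
  obtain ⟨D, hD⟩ := hLc.exists_bound_of_continuousOn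
    (f := fun q : ℂ × ℂ => 2 * γ * q.1) (by fun_prop)
  obtain ⟨E, hE⟩ := hLc.exists_bound_of_continuousOn
    (f := fun q : ℂ × ℂ => 2 * γ * q.2) (by fun_prop)
  set M : ℝ := max (max A B) (max D E)
  set R : ℝ := max 1 (2 * M ^ 2 / (4 * ‖z‖ ^ 2))
  have hz4 : 0 < 4 * ‖z‖ ^ 2 := by positivity
  have hR1 : 1 ≤ R := le_max_left _ _
  refine ⟨{t : ℂ | R < ‖exp (γ * t * I)‖}, ⟨Real.log (R + 1) / (γ * I), ?_⟩,
    isOpen_lt continuous_const (by fun_prop), ?_⟩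
  · have ht : γ * (Real.log (R + 1) / (γ * I)) * I = Real.log (R + 1) := by
      field_simp
    rw [Set.mem_ofPred_eq, ht, norm_exp, ofReal_re, Real.exp_log (by linarith)]
    linarith
  · intro t ht p hp q hq
    have ht' : R < ‖exp (γ * t * I)‖ := ht
    have hs : 1 ≤ ‖exp (γ * t * I)‖ := hR1.trans ht'.le
    have hlt : 2 * M ^ 2 < 4 * ‖z‖ ^ 2 * ‖exp (γ * t * I)‖ := by
      rw [← div_lt_iff₀' hz4]
      exact (le_max_right _ _).trans_lt ht'
    have hpF : p.1 ^ 2 + p.2 ^ 2 + z ^ 2 = 3 * p.1 * p.2 * z := hK hp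
    refine ⟨fun h => hlt.not_ge ?_, fun h => hlt.not_ge ?_⟩
    · refine norm_exp_le_of_cos_add_sin_eq hγ0 ?_ ((hA p hp).trans (by simp [M]))
        ((hD q hq).trans (by simp [M])) hs h
      rw [hγ]
      linear_combination 4 * hpF
    · refine norm_exp_le_of_cos_add_sin_eq hγ0 ?_ ((hB p hp).trans (by simp [M]))
        ((hE q hq).trans (by simp [M])) hs (Eq.trans ?_ h)
      · rw [hγ]
        linear_combination 4 * hpF
      · simp only [markovFlowZ]
        ring
end

section
/- For every injective map ι : T → T there exist entire functions f, g, h : ℂ → ℂ such that the map F : M₀ → M₀ defined by F = G⁻¹ ∘ Φ^x ∘ Φ^y ∘ G — where G(p) := φ^z_{f(ζ(p))}(p) with ζ(p) the z-coordinate of p (so that G⁻¹(q) = φ^z_{−f(ζ(q))}(q)), Φ^y(q) := φ^y_{g(υ(q))}(q) with υ(q) the y-coordinate of q, and Φ^x(q) := φ^x_{h(ξ(q))}(q) with ξ(q) the x-coordinate of q — is a bijection of M₀ onto itself and satisfies F(p) = ι(p) for every ordered Markov triple p ∈ T. In particular, every injective self-map of the set of ordered Markov triples is realized by an automorphism of the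 Markov surface that is a composition of flows of complete shear vector fields (this is the concrete content of the statement that the ordered Markov triples form a tame subset of the Markov surface). -/
/-- The entire function `c(w,t) = Σ_{n≥0} (−1)ⁿ wⁿ t^{2n}/(2n)!`, so that
`c(γ², t) = cos(γt)` for any square root `γ` of `w`. -/
noncomputable def entireCos (w t : ℂ) : ℂ :=
  ∑' n : ℕ, (-1 : ℂ)^n * w^n * t^(2*n) / (Nat.factorial (2*n) : ℂ)

/-- The entire function `s(w,t) = Σ_{n≥0} (−1)ⁿ wⁿ t^{2n+1}/(2n+1)!`, so that
`s(γ², t) = sin(γt)/γ` for any square root `γ` of `w`. -/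
noncomputable def entireSin (w t : ℂ) : ℂ :=
  ∑' n : ℕ, (-1 : ℂ)^n * w^n * t^(2*n+1) / (Nat.factorial (2*n+1) : ℂ)

/-- The Markov surface `M₀ = {(x,y,z) ∈ ℂ³ : x² + y² + z² = 3xyz}`. -/
def markovSurface : Set (ℂ × ℂ × ℂ) :=
  {p | p.1^2 + p.2.1^2 + p.2.2^2 = 3 * p.1 * p.2.1 * p.2.2}

/-- The set `T` of ordered Markov triples: points of the Markov surface whose coordinates
are positive integers `x ≤ y ≤ z`. -/
def orderedMarkovTriples : Set (ℂ × ℂ × ℂ) :=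
  {p | p ∈ markovSurface ∧
    ∃ a b c : ℕ, 0 < a ∧ 0 < b ∧ 0 < c ∧ a ≤ b ∧ b ≤ c ∧ p = ((a : ℂ), (b : ℂ), (c : ℂ))}

/-- The time-`t` flow `φ^z_t` of the complete tangential vector field `V^z` on the Markov
surface. -/
noncomputable def flowZ (t : ℂ) (p : ℂ × ℂ × ℂ) : ℂ × ℂ × ℂ :=
  (p.1 * entireCos (4 - 9*p.2.2^2) t + (2*p.2.1 - 3*p.1*p.2.2) * entireSin (4 - 9*p.2.2^2) t,
   p.2.1 * entireCos (4 - 9*p.2.2^2) t - (2*p.1 - 3*p.2.1*p.2.2) * entireSin (4 - 9*p.2.2^2) t,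
   p.2.2)

/-- The time-`t` flow `φ^x_t` of the complete tangential vector field `V^x` on the Markov
surface. -/
noncomputable def flowX (t : ℂ) (p : ℂ × ℂ × ℂ) : ℂ × ℂ × ℂ :=
  (p.1,
   p.2.1 * entireCos (4 - 9*p.1^2) t + (2*p.2.2 - 3*p.1*p.2.1) * entireSin (4 - 9*p.1^2) t,
   p.2.2 * entireCos (4 - 9*p.1^2) t - (2*p.2.1 - 3*p.1*p.2.2) * entireSin (4 - 9*p.1^2) t)

/-- The time-`t` flow `φ^y_t` of the complete tangential vector field `V^y` on the Markov
surface. -/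
noncomputable def flowY (t : ℂ) (p : ℂ × ℂ × ℂ) : ℂ × ℂ × ℂ :=
  (p.1 * entireCos (4 - 9*p.2.1^2) t - (2*p.2.2 - 3*p.1*p.2.1) * entireSin (4 - 9*p.2.1^2) t,
   p.2.1,
   p.2.2 * entireCos (4 - 9*p.2.1^2) t + (2*p.1 - 3*p.2.1*p.2.2) * entireSin (4 - 9*p.2.1^2) t)

theorem entireCos_sq (γ t : ℂ) : entireCos (γ ^ 2) t = Complex.cos (γ * t) := by
  rw [entireCos, ← (Complex.hasSum_cos (γ * t)).tsum_eq]
  congr 1 with n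
  rw [mul_pow, pow_mul γ, ← mul_assoc]

theorem mul_entireSin_sq (γ t : ℂ) : γ * entireSin (γ ^ 2) t = Complex.sin (γ * t) := by
  rw [entireSin, ← (Complex.hasSum_sin (γ * t)).tsum_eq, ← tsum_mul_left]
  congr 1 with n
  rw [← pow_mul]
  ring

theorem entireCos_neg (w t : ℂ) : entireCos w (-t) = entireCos w t := by
  simp only [entireCos, (even_two_mul _).neg_pow]

theorem entireSin_neg (w t : ℂ) : entireSin w (-t) = -entireSin w t := by
  simp only [entireSin, (odd_two_mul_add_one _).neg_pow, mul_neg, neg_div, tsum_neg]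

theorem entireCos_sq_add_mul_entireSin_sq (w t : ℂ) :
    entireCos w t ^ 2 + w * entireSin w t ^ 2 = 1 := by
  obtain ⟨γ, rfl⟩ := IsAlgClosed.exists_pow_nat_eq w zero_lt_two
  rw [← mul_pow, mul_entireSin_sq, entireCos_sq, Complex.cos_sq_add_sin_sq]

theorem flowZ_neg_flowZ (t : ℂ) (p : ℂ × ℂ × ℂ) : flowZ (-t) (flowZ t p) = p := by
  have h := entireCos_sq_add_mul_entireSin_sq (4 - 9 * p.2.2 ^ 2) t
  simp only [flowZ, entireCos_neg, entireSin_neg]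
  ext
  · linear_combination p.1 * h
  · linear_combination p.2.1 * h
  · rfl

theorem flowY_neg_flowY (t : ℂ) (p : ℂ × ℂ × ℂ) : flowY (-t) (flowY t p) = p := by
  have h := entireCos_sq_add_mul_entireSin_sq (4 - 9 * p.2.1 ^ 2) t
  simp only [flowY, entireCos_neg, entireSin_neg]
  ext
  · linear_combination p.1 * h
  · rfl
  · linear_combination p.2.2 * h

theorem flowX_neg_flowX (t : ℂ) (p : ℂ × ℂ × ℂ) : flowX (-t) (flowX t p) = p := by
  have h := entireCos_sq_add_mul_entireSin_sq (4 - 9 * p.1 ^ 2) t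
  simp only [flowX, entireCos_neg, entireSin_neg]
  ext
  · rfl
  · linear_combination p.2.1 * h
  · linear_combination p.2.2 * h

theorem flowZ_mem_markovSurface (t : ℂ) {p : ℂ × ℂ × ℂ} (hp : p ∈ markovSurface) :
    flowZ t p ∈ markovSurface := by
  have h := entireCos_sq_add_mul_entireSin_sq (4 - 9 * p.2.2 ^ 2) t
  simp only [markovSurface, Set.mem_ofPred_eq, flowZ] at hp ⊢
  linear_combination hp + (p.1 ^ 2 + p.2.1 ^ 2 - 3 * p.2.2 * p.1 * p.2.1) * h

theorem flowY_mem_markovSurface (t : ℂ) {p : ℂ × ℂ × ℂ} (hp : p ∈ markovSurface) :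
    flowY t p ∈ markovSurface := by
  have h := entireCos_sq_add_mul_entireSin_sq (4 - 9 * p.2.1 ^ 2) t
  simp only [markovSurface, Set.mem_ofPred_eq, flowY] at hp ⊢
  linear_combination hp + (p.1 ^ 2 + p.2.2 ^ 2 - 3 * p.2.1 * p.1 * p.2.2) * h

theorem flowX_mem_markovSurface (t : ℂ) {p : ℂ × ℂ × ℂ} (hp : p ∈ markovSurface) :
    flowX t p ∈ markovSurface := by
  have h := entireCos_sq_add_mul_entireSin_sq (4 - 9 * p.1 ^ 2) t
  simp only [markovSurface, Set.mem_ofPred_eq, flowX] at hp ⊢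
  linear_combination hp + (p.2.1 ^ 2 + p.2.2 ^ 2 - 3 * p.1 * p.2.1 * p.2.2) * h

theorem bijOn_flowZ (f : ℂ → ℂ) :
    Set.BijOn (fun p => flowZ (f p.2.2) p) markovSurface markovSurface :=
  Set.InvOn.bijOn (f' := fun p => flowZ (-f p.2.2) p)
    ⟨fun p _ => flowZ_neg_flowZ (f p.2.2) p,
      fun p _ => by
        have := flowZ_neg_flowZ (-f p.2.2) p
        rwa [neg_neg] at this⟩
    (fun _ hp => flowZ_mem_markovSurface _ hp) fun _ hp => flowZ_mem_markovSurface _ hp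

theorem bijOn_flowY (g : ℂ → ℂ) :
    Set.BijOn (fun p => flowY (g p.2.1) p) markovSurface markovSurface :=
  Set.InvOn.bijOn (f' := fun p => flowY (-g p.2.1) p)
    ⟨fun p _ => flowY_neg_flowY (g p.2.1) p,
      fun p _ => by
        have := flowY_neg_flowY (-g p.2.1) p
        rwa [neg_neg] at this⟩
    (fun _ hp => flowY_mem_markovSurface _ hp) fun _ hp => flowY_mem_markovSurface _ hp

theorem bijOn_flowX (h : ℂ → ℂ) :
    Set.BijOn (fun p => flowX (h p.1) p) markovSurface markovSurface :=
  Set.InvOn.bijOn (f' := fun p => flowX (-h p.1) p)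
    ⟨fun p _ => flowX_neg_flowX (h p.1) p,
      fun p _ => by
        have := flowX_neg_flowX (-h p.1) p
        rwa [neg_neg] at this⟩
    (fun _ hp => flowX_mem_markovSurface _ hp) fun _ hp => flowX_mem_markovSurface _ hp

theorem Complex.exists_cos_eq_sin_eq {a b : ℂ} (h : a ^ 2 + b ^ 2 = 1) :
    ∃ θ, Complex.cos θ = a ∧ Complex.sin θ = b := by
  have hI := Complex.I_sq
  have hmul : (a + b * Complex.I) * (a - b * Complex.I) = 1 := by
    linear_combination h - b ^ 2 * hI
  have hne : a + b * Complex.I ≠ 0 := left_ne_zero_of_mul_eq_one hmul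
  have h₁ : Complex.exp (Complex.log (a + b * Complex.I)) = a + b * Complex.I :=
    Complex.exp_log hne
  have h₂ : Complex.exp (-Complex.log (a + b * Complex.I)) = a - b * Complex.I := by
    rw [Complex.exp_neg, h₁, inv_eq_of_mul_eq_one_right hmul]
  refine ⟨-Complex.I * Complex.log (a + b * Complex.I), ?_, ?_⟩
  · rw [Complex.cos, show -Complex.I * Complex.log (a + b * Complex.I) * Complex.I =
      Complex.log (a + b * Complex.I) by linear_combination -Complex.log _ * hI,
      show -(-Complex.I * Complex.log (a + b * Complex.I)) * Complex.I =
      -Complex.log (a + b * Complex.I) by linear_combination Complex.log _ * hI, h₁, h₂]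
    ring
  · rw [Complex.sin, show -Complex.I * Complex.log (a + b * Complex.I) * Complex.I =
      Complex.log (a + b * Complex.I) by linear_combination -Complex.log _ * hI,
      show -(-Complex.I * Complex.log (a + b * Complex.I)) * Complex.I =
      -Complex.log (a + b * Complex.I) by linear_combination Complex.log _ * hI, h₁, h₂]
    linear_combination -b * hI

theorem exists_entireCos_eq_entireSin_eq {w a b : ℂ} (hw : w ≠ 0) (h : a ^ 2 + w * b ^ 2 = 1) :
    ∃ t, entireCos w t = a ∧ entireSin w t = b := by
  obtain ⟨γ, rfl⟩ := IsAlgClosed.exists_pow_nat_eq w zero_lt_two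
  have hγ : γ ≠ 0 := by rintro rfl; simp at hw
  obtain ⟨θ, hc, hs⟩ := Complex.exists_cos_eq_sin_eq (a := a) (b := γ * b) (by rw [mul_pow, h])
  have hθ : γ * (θ / γ) = θ := mul_div_cancel₀ θ hγ
  exact ⟨θ / γ, by rw [entireCos_sq, hθ, hc],
    mul_left_cancel₀ hγ (by rw [mul_entireSin_sq, hθ, hs])⟩

/-- The shear flow is transitive on a smooth non-degenerate conic in the Markov surface. -/
theorem exists_flow_conic {k x y x' y' : ℂ} (hk : 1 < ‖k‖)
    (h : x ^ 2 + y ^ 2 + k ^ 2 = 3 * k * x * y) (h' : x' ^ 2 + y' ^ 2 + k ^ 2 = 3 * k * x' * y') :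
    ∃ t, x * entireCos (4 - 9 * k ^ 2) t + (2 * y - 3 * x * k) * entireSin (4 - 9 * k ^ 2) t = x' ∧
      y * entireCos (4 - 9 * k ^ 2) t - (2 * x - 3 * y * k) * entireSin (4 - 9 * k ^ 2) t = y' := by
  have hk0 : k ≠ 0 := norm_pos_iff.mp (zero_lt_one.trans hk)
  have hw : 4 - 9 * k ^ 2 ≠ 0 := by
    intro hw
    have : ‖(9 : ℂ) * k ^ 2‖ = ‖(4 : ℂ)‖ := by rw [sub_eq_zero.mp hw]
    norm_num at this
    nlinarith
  obtain ⟨t, hc, hs⟩ := exists_entireCos_eq_entireSin_eq hw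
    (a := (-(2 * x - 3 * y * k) * x' - (2 * y - 3 * x * k) * y') / (2 * k ^ 2))
    (b := (x * y' - y * x') / (2 * k ^ 2)) (by
      field_simp
      linear_combination 4 * (x' ^ 2 + y' ^ 2 - 3 * k * x' * y') * h - 4 * k ^ 2 * h')
  refine ⟨t, ?_, ?_⟩ <;> rw [hc, hs] <;> field_simp
  · linear_combination -2 * x' * h
  · linear_combination -2 * y' * h

open Filter Polynomial in
/-- One step of Newton interpolation: a polynomial `S` can be corrected at a new node `c n` without
changing its values at the earlier nodes, by a polynomial that is small on a large disc. -/
theorem exists_newton_correction {c : ℕ → ℂ} (hc : c.Injective) (hc0 : ∀ n, c n ≠ 0) (v : ℂ)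
    (n : ℕ) (S : ℂ[X]) :
    ∃ q : ℂ[X], (∀ k < n, q.eval (c k) = 0) ∧ (S + q).eval (c n) = v ∧
      ∀ z, ‖z‖ ≤ ‖c n‖ / 2 → ‖q.eval z‖ ≤ (1 / 2) ^ n := by
  set P : ℂ[X] := ∏ k ∈ Finset.range n, (X - C (c k)) with hP
  have hPn : P.eval (c n) ≠ 0 := by
    rw [hP, eval_prod, Finset.prod_ne_zero_iff]
    intro k hk
    rw [eval_sub, eval_X, eval_C, sub_ne_zero]
    exact hc.ne (Finset.mem_range.mp hk).ne'
  set a := (v - S.eval (c n)) / P.eval (c n) with ha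
  obtain ⟨K, hK⟩ := (isCompact_closedBall (0 : ℂ) (‖c n‖ / 2)).exists_bound_of_continuousOn
    (f := fun z => a * P.eval z) (by fun_prop)
  have hlim : Tendsto (fun m : ℕ => K * (1 / 2 : ℝ) ^ m) atTop (nhds (K * 0)) :=
    (tendsto_pow_atTop_nhds_zero_of_lt_one (by norm_num) (by norm_num)).const_mul K
  rw [mul_zero] at hlim
  obtain ⟨m, hm⟩ := (hlim.eventually_le_const (show (0 : ℝ) < (1 / 2) ^ n by positivity)).exists
  refine ⟨C a * P * (C (c n)⁻¹ * X) ^ m, fun k hk => ?_, ?_, fun z hz => ?_⟩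
  · have : P.eval (c k) = 0 := by
      rw [hP, eval_prod]
      exact Finset.prod_eq_zero (Finset.mem_range.mpr hk) (by simp)
    simp [this]
  · simp [inv_mul_cancel₀ (hc0 n), ha, div_mul_cancel₀ _ hPn]
  · have hzc : ‖(c n)⁻¹ * z‖ ≤ 1 / 2 := by
      rw [norm_mul, norm_inv, inv_mul_le_iff₀ (norm_pos_iff.mpr (hc0 n))]
      linarith
    have hKz := hK z (by simpa using hz)
    calc ‖(C a * P * (C (c n)⁻¹ * X) ^ m).eval z‖
        = ‖a * P.eval z‖ * ‖(c n)⁻¹ * z‖ ^ m := by simp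
      _ ≤ K * (1 / 2) ^ m := by
          gcongr
          exact (norm_nonneg _).trans hKz
      _ ≤ (1 / 2) ^ n := hm

open Filter Polynomial in
theorem exists_entire_interpolation_nat {c : ℕ → ℂ} (hc : c.Injective) (hc0 : ∀ n, c n ≠ 0)
    (hlim : Tendsto (fun n => ‖c n‖) atTop atTop) (v : ℕ → ℂ) :
    ∃ f : ℂ → ℂ, Differentiable ℂ f ∧ ∀ n, f (c n) = v n := by
  choose q hq0 hqv hqb using fun n => exists_newton_correction hc hc0 (v n) n
  let S : ℕ → ℂ[X] := fun n => Nat.rec 0 (fun n S => S + q n S) n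
  have hS : ∀ n, S (n + 1) = S n + q n (S n) := fun n => rfl
  have hsum : ∀ n, S n = ∑ i ∈ Finset.range n, q i (S i) := by
    intro n
    induction n with
    | zero => rfl
    | succ n ih => rw [Finset.sum_range_succ, ← ih, hS]
  refine ⟨fun z => ∑' n, (q n (S n)).eval z, fun z => ?_, fun n => ?_⟩
  · have hopen : IsOpen (Metric.ball (0 : ℂ) (‖z‖ + 1)) := Metric.isOpen_ball
    have hbound : ∀ n, ∃ K, ∀ w ∈ Metric.closedBall (0 : ℂ) (‖z‖ + 1),
        ‖(q n (S n)).eval w‖ ≤ K := fun n =>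
      (isCompact_closedBall _ _).exists_bound_of_continuousOn (by fun_prop)
    choose K hK using hbound
    have hev : ∀ᶠ n in cofinite, ‖z‖ + 1 ≤ ‖c n‖ / 2 := by
      rw [Nat.cofinite_eq_atTop]
      exact (hlim.atTop_div_const two_pos).eventually_ge_atTop _
    classical
    let u : ℕ → ℝ := fun n => if ‖z‖ + 1 ≤ ‖c n‖ / 2 then (1 / 2) ^ n else K n
    have hu : Summable u :=
      summable_geometric_two.congr_cofinite (hev.mono fun n hn => (if_pos hn).symm)
    refine (Complex.differentiableOn_tsum_of_summable_norm hu
      (fun n => (q n (S n)).differentiable.differentiableOn) hopen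
      fun n w hw => ?_).differentiableAt (hopen.mem_nhds (by simp))
    rw [mem_ball_zero_iff] at hw
    by_cases h : ‖z‖ + 1 ≤ ‖c n‖ / 2
    · simpa only [u, if_pos h] using hqb n (S n) w (hw.le.trans h)
    · simpa only [u, if_neg h] using hK n w (by simpa using hw.le)
  · have h0 : ∀ m ∉ Finset.range (n + 1), (q m (S m)).eval (c n) = 0 := fun m hm =>
      hq0 m _ n (by simpa using hm)
    change ∑' m, (q m (S m)).eval (c n) = v n
    rw [tsum_eq_sum h0, ← eval_finsetSum, ← hsum, hS, hqv]

open Filter in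
/-- Interpolation of arbitrary values by an entire function along a closed discrete set. -/
theorem exists_entire_eqOn {A : Set ℂ} (h0 : 0 ∉ A) (hA : ∀ R : ℝ, {z ∈ A | ‖z‖ ≤ R}.Finite)
    (v : ℂ → ℂ) : ∃ f : ℂ → ℂ, Differentiable ℂ f ∧ Set.EqOn f v A := by
  -- Adding the positive integers makes the set of nodes infinite.
  set B : Set ℂ := A ∪ Set.range fun n : ℕ => (n : ℂ) + 1 with hB
  have hB0 : 0 ∉ B := by
    rintro (h | ⟨n, hn⟩)
    · exact h0 h
    · exact Nat.cast_add_one_ne_zero n hn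
  have hBR : ∀ R : ℝ, {z ∈ B | ‖z‖ ≤ R}.Finite := by
    intro R
    refine ((hA R).union ((Set.finite_Iic ⌊R⌋₊).image fun n : ℕ => (n : ℂ) + 1)).subset ?_
    rintro z ⟨hz | ⟨n, rfl⟩, hR⟩
    · exact Or.inl ⟨hz, hR⟩
    · refine Or.inr ⟨n, Nat.le_floor ?_, rfl⟩
      have : ‖(n : ℂ) + 1‖ = n + 1 := by
        rw [← Nat.cast_add_one, Complex.norm_natCast, Nat.cast_add_one]
      simp only at hR
      linarith
  have hcount : B.Countable := by
    have : B ⊆ ⋃ n : ℕ, {z ∈ B | ‖z‖ ≤ n} := fun z hz =>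
      Set.mem_iUnion.mpr ((exists_nat_ge ‖z‖).imp fun n hn => ⟨hz, hn⟩)
    exact (Set.countable_iUnion fun n : ℕ => (hBR n).countable).mono this
  have hinf : B.Infinite := (Set.infinite_range_of_injective fun m n h => by
    simpa using h).mono Set.subset_union_right
  have := hcount.to_subtype
  have := hinf.to_subtype
  obtain ⟨_⟩ := nonempty_denumerable B
  let e := (Denumerable.eqv B).symm
  have hinj : Function.Injective fun n => (e n : ℂ) := Subtype.val_injective.comp e.injective
  obtain ⟨f, hf, hfv⟩ := exists_entire_interpolation_nat hinj
    (fun n h => hB0 (h ▸ (e n).2)) (by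
      rw [← Nat.cofinite_eq_atTop, tendsto_atTop]
      intro R
      refine ((hBR R).preimage hinj.injOn).subset fun n hn => ⟨(e n).2, ?_⟩
      exact le_of_not_ge fun h => hn h) (fun n => v (e n))
  refine ⟨f, hf, fun z hz => ?_⟩
  simpa using hfv (e.symm ⟨z, Or.inl hz⟩)

/-- Interpolation along an injective family of nodes tending to infinity. -/
theorem exists_entire_interpolation {α : Type*} {A : Set α} {c : α → ℂ} (hc : A.InjOn c)
    (h0 : ∀ p ∈ A, c p ≠ 0) (hA : ∀ R : ℝ, {p ∈ A | ‖c p‖ ≤ R}.Finite) (v : α → ℂ) :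
    ∃ f : ℂ → ℂ, Differentiable ℂ f ∧ ∀ p ∈ A, f (c p) = v p := by
  rcases isEmpty_or_nonempty α with _ | _
  · exact ⟨fun _ => 0, differentiable_const 0, fun p => isEmptyElim p⟩
  obtain ⟨f, hf, hfv⟩ := exists_entire_eqOn (A := c '' A)
    (by rintro ⟨p, hp, h⟩; exact h0 p hp h)
    (fun R => ((hA R).image c).subset (by rintro _ ⟨⟨p, hp, rfl⟩, hR⟩; exact ⟨p, ⟨hp, hR⟩, rfl⟩))
    (v ∘ Function.invFunOn c A)
  refine ⟨f, hf, fun p hp => ?_⟩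
  rw [hfv ⟨p, hp, rfl⟩, Function.comp_apply, hc.leftInvOn_invFunOn hp]

/-- At real times, the flow over a positive integer is a combination of real exponentials. -/
theorem exists_entireCos_entireSin_eq_exp {n : ℕ} (hn : n ≠ 0) :
    ∃ κ : ℝ, 0 < κ ∧ (κ : ℂ) ^ 2 = 9 * (n : ℂ) ^ 2 - 4 ∧ ∀ (A B : ℂ) (t : ℝ),
      2 * κ * (A * entireCos (4 - 9 * (n : ℂ) ^ 2) t + B * entireSin (4 - 9 * (n : ℂ) ^ 2) t) =
        (A * κ + B) * (Real.exp (κ * t) : ℝ) + (A * κ - B) * (Real.exp (-(κ * t)) : ℝ) := by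
  have hn1 : (1 : ℝ) ≤ n := by exact_mod_cast Nat.one_le_iff_ne_zero.mpr hn
  have hpos : (0 : ℝ) < 9 * (n : ℝ) ^ 2 - 4 := by nlinarith
  have hsq : ((√(9 * (n : ℝ) ^ 2 - 4) : ℝ) : ℂ) ^ 2 = 9 * (n : ℂ) ^ 2 - 4 := by
    rw [← Complex.ofReal_pow, Real.sq_sqrt hpos.le]
    push_cast
    rfl
  refine ⟨√(9 * (n : ℝ) ^ 2 - 4), Real.sqrt_pos.mpr hpos, hsq, fun A B t => ?_⟩
  set κ := √(9 * (n : ℝ) ^ 2 - 4)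
  have hw : 4 - 9 * (n : ℂ) ^ 2 = (κ * Complex.I) ^ 2 := by
    rw [mul_pow, hsq, Complex.I_sq]
    ring
  have hs := mul_entireSin_sq (κ * Complex.I) t
  have hc := entireCos_sq (κ * Complex.I) t
  have hI : (κ : ℂ) * Complex.I * t = (κ * t : ℂ) * Complex.I := by ring
  rw [hI, Complex.sin_mul_I] at hs
  rw [hI, Complex.cos_mul_I] at hc
  replace hs : κ * entireSin ((κ * Complex.I) ^ 2) t = Complex.sinh (κ * t) :=
    mul_right_cancel₀ Complex.I_ne_zero (by rw [← hs]; ring)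
  rw [hw, hc, Complex.ofReal_exp, Complex.ofReal_exp, Complex.ofReal_neg, Complex.ofReal_mul]
  have h₁ := Complex.cosh_add_sinh (κ * t : ℂ)
  have h₂ := Complex.cosh_sub_sinh (κ * t : ℂ)
  linear_combination 2 * B * hs + (A * κ + B) * h₁ + (A * κ - B) * h₂

open Filter in
theorem tendsto_norm_flow_atTop {n : ℕ} (hn : n ≠ 0) {A B : ℂ}
    (h : A ^ 2 * (9 * (n : ℂ) ^ 2 - 4) ≠ B ^ 2) :
    Tendsto (fun t : ℝ => ‖A * entireCos (4 - 9 * (n : ℂ) ^ 2) t +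
      B * entireSin (4 - 9 * (n : ℂ) ^ 2) t‖) atTop atTop := by
  obtain ⟨κ, hκ, hκn, hexp⟩ := exists_entireCos_entireSin_eq_exp hn
  have hα : 0 < ‖A * κ + B‖ := norm_pos_iff.mpr fun h0 => h (by
    rw [← hκn]
    linear_combination (A * κ - B) * h0)
  have hlim : Tendsto (fun t : ℝ => (‖A * κ + B‖ * Real.exp (κ * t) - ‖A * κ - B‖) / (2 * κ))
      atTop atTop :=
    (tendsto_atTop_add_const_right _ _ ((Real.tendsto_exp_atTop.comp
      (tendsto_id.const_mul_atTop hκ)).const_mul_atTop hα)).atTop_div_const (by positivity)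
  refine tendsto_atTop_mono' _ ?_ hlim
  filter_upwards [eventually_ge_atTop 0] with t ht
  have hle : Real.exp (-(κ * t)) ≤ 1 := Real.exp_le_one_iff.mpr (by nlinarith)
  have hnorm := congrArg norm (hexp A B t)
  have htri := norm_sub_le ((A * κ + B) * (Real.exp (κ * t) : ℝ) +
    (A * κ - B) * (Real.exp (-(κ * t)) : ℝ)) ((A * κ - B) * (Real.exp (-(κ * t)) : ℝ))
  rw [add_sub_cancel_right, ← hnorm] at htri
  simp only [norm_mul, Complex.norm_real, Real.norm_eq_abs, Real.abs_exp, abs_of_pos hκ,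
    Complex.norm_ofNat] at htri
  rw [div_le_iff₀ (by positivity)]
  nlinarith [mul_le_mul_of_nonneg_left hle (norm_nonneg (A * κ - B))]

open Filter in
theorem eventually_flow_ne_zero {n : ℕ} (hn : n ≠ 0) {A B : ℂ} (h : A ≠ 0 ∨ B ≠ 0) :
    ∀ᶠ t : ℝ in atTop, A * entireCos (4 - 9 * (n : ℂ) ^ 2) t +
      B * entireSin (4 - 9 * (n : ℂ) ^ 2) t ≠ 0 := by
  by_cases hAB : A ^ 2 * (9 * (n : ℂ) ^ 2 - 4) = B ^ 2
  · obtain ⟨κ, hκ, hκn, hexp⟩ := exists_entireCos_entireSin_eq_exp hn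
    have hκ0 : (κ : ℂ) ≠ 0 := Complex.ofReal_ne_zero.mpr hκ.ne'
    refine Eventually.of_forall fun t ht => ?_
    have h0 := hexp A B t
    rw [ht, mul_zero] at h0
    have hprod : (A * κ + B) * (A * κ - B) = 0 := by
      rw [← hκn] at hAB
      linear_combination hAB
    have hboth : A * κ + B = 0 ∧ A * κ - B = 0 := by
      rcases mul_eq_zero.mp hprod with h' | h' <;> simpa [h'] using h0
    have hA : A = 0 := by
      have : 2 * (A * κ) = 0 := by linear_combination hboth.1 + hboth.2
      simpa [hκ0] using this
    have hB : B = 0 := by simpa [hA] using hboth.1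
    tauto
  · filter_upwards [(tendsto_norm_flow_atTop hn hAB).eventually_gt_atTop 0] with t ht
    exact norm_pos_iff.mp ht

open Filter in
theorem tendsto_norm_flowZ_fst {n : ℕ} (hn : n ≠ 0) {p : ℂ × ℂ × ℂ} (hp : p ∈ markovSurface)
    (hpn : p.2.2 = n) : Tendsto (fun t : ℝ => ‖(flowZ t p).1‖) atTop atTop := by
  have hn' : (n : ℂ) ≠ 0 := Nat.cast_ne_zero.mpr hn
  simp only [flowZ, hpn]
  refine tendsto_norm_flow_atTop hn fun h => pow_ne_zero 2 hn' ?_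
  simp only [markovSurface, Set.mem_ofPred_eq, hpn] at hp
  linear_combination h / 4 + hp

open Filter in
theorem tendsto_norm_flowZ_snd {n : ℕ} (hn : n ≠ 0) {p : ℂ × ℂ × ℂ} (hp : p ∈ markovSurface)
    (hpn : p.2.2 = n) : Tendsto (fun t : ℝ => ‖(flowZ t p).2.1‖) atTop atTop := by
  have hn' : (n : ℂ) ≠ 0 := Nat.cast_ne_zero.mpr hn
  simp only [flowZ, hpn, sub_eq_add_neg (p.2.1 * _), ← neg_mul]
  refine tendsto_norm_flow_atTop hn fun h => pow_ne_zero 2 hn' ?_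
  simp only [markovSurface, Set.mem_ofPred_eq, hpn] at hp
  linear_combination h / 4 + hp

open Filter in
theorem eventually_flowZ_fst_ne {n : ℕ} (hn : n ≠ 0) {p q : ℂ × ℂ × ℂ} (hpn : p.2.2 = n)
    (hqn : q.2.2 = n) (hpq : p ≠ q) :
    ∀ᶠ t : ℝ in atTop, (flowZ t p).1 ≠ (flowZ t q).1 := by
  have hAB : p.1 - q.1 ≠ 0 ∨
      (2 * p.2.1 - 3 * p.1 * n) - (2 * q.2.1 - 3 * q.1 * n) ≠ 0 := by
    by_contra! h
    refine hpq (Prod.ext (sub_eq_zero.mp h.1) (Prod.ext ?_ (hpn.trans hqn.symm)))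
    linear_combination h.2 / 2 + 3 / 2 * n * h.1
  filter_upwards [eventually_flow_ne_zero hn hAB] with t ht heq
  simp only [flowZ, hpn, hqn] at heq
  exact ht (by linear_combination heq)

open Filter in
theorem eventually_flowZ_snd_ne {n : ℕ} (hn : n ≠ 0) {p q : ℂ × ℂ × ℂ} (hpn : p.2.2 = n)
    (hqn : q.2.2 = n) (hpq : p ≠ q) :
    ∀ᶠ t : ℝ in atTop, (flowZ t p).2.1 ≠ (flowZ t q).2.1 := by
  have hAB : p.2.1 - q.2.1 ≠ 0 ∨
      -(2 * p.1 - 3 * p.2.1 * n) + (2 * q.1 - 3 * q.2.1 * n) ≠ 0 := by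
    by_contra! h
    refine hpq (Prod.ext ?_ (Prod.ext (sub_eq_zero.mp h.1) (hpn.trans hqn.symm)))
    linear_combination -h.2 / 2 + 3 / 2 * n * h.1
  filter_upwards [eventually_flow_ne_zero hn hAB] with t ht heq
  simp only [flowZ, hpn, hqn] at heq
  exact ht (by linear_combination heq)

theorem exists_nat_of_mem_orderedMarkovTriples {p : ℂ × ℂ × ℂ} (hp : p ∈ orderedMarkovTriples) :
    ∃ n : ℕ, n ≠ 0 ∧ p.2.2 = n := by
  obtain ⟨-, a, b, n, -, -, hn, -, -, rfl⟩ := hp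
  exact ⟨n, hn.ne', rfl⟩

theorem finite_orderedMarkovTriples_fiber (n : ℕ) :
    {p ∈ orderedMarkovTriples | p.2.2 = n}.Finite := by
  refine (((Set.finite_Iic n).prod (Set.finite_Iic n)).image
    fun m : ℕ × ℕ => ((m.1 : ℂ), (m.2 : ℂ), (n : ℂ))).subset ?_
  rintro _ ⟨⟨-, a, b, c, -, -, -, hab, hbc, rfl⟩, hn⟩
  obtain rfl : c = n := Nat.cast_injective hn
  exact ⟨(a, b), ⟨hab.trans hbc, hbc⟩, rfl⟩

/-- A time for the flow over `n` which separates both coordinates of the fibre and moves it into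
an annulus with a prescribed inner radius. -/
theorem exists_time_fiber (n : ℕ) (r : ℝ) :
    ∃ (t : ℂ) (r' : ℝ), r + 1 ≤ r' ∧ ∀ p ∈ orderedMarkovTriples, p.2.2 = n →
      (r < ‖(flowZ t p).1‖ ∧ ‖(flowZ t p).1‖ ≤ r') ∧
      (r < ‖(flowZ t p).2.1‖ ∧ ‖(flowZ t p).2.1‖ ≤ r') ∧
      ∀ q ∈ orderedMarkovTriples, q.2.2 = n → p ≠ q →
        (flowZ t p).1 ≠ (flowZ t q).1 ∧ (flowZ t p).2.1 ≠ (flowZ t q).2.1 := by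
  have hfin := finite_orderedMarkovTriples_fiber n
  set Fib := {p ∈ orderedMarkovTriples | p.2.2 = n}
  have hn : ∀ p ∈ Fib, n ≠ 0 := by
    rintro p ⟨hp, hpn⟩ rfl
    obtain ⟨m, hm, hpm⟩ := exists_nat_of_mem_orderedMarkovTriples hp
    exact hm (Nat.cast_injective (hpm.symm.trans hpn))
  have hev : ∀ᶠ t : ℝ in Filter.atTop, ∀ p ∈ Fib,
      (r < ‖(flowZ t p).1‖ ∧ r < ‖(flowZ t p).2.1‖) ∧
      ∀ q ∈ Fib, p ≠ q →
        (flowZ t p).1 ≠ (flowZ t q).1 ∧ (flowZ t p).2.1 ≠ (flowZ t q).2.1 := by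
    refine (Filter.eventually_all_finite hfin).mpr fun p hp => ?_
    refine (((tendsto_norm_flowZ_fst (hn p hp) hp.1.1 hp.2).eventually_gt_atTop r).and
      ((tendsto_norm_flowZ_snd (hn p hp) hp.1.1 hp.2).eventually_gt_atTop r)).and ?_
    refine (Filter.eventually_all_finite hfin).mpr fun q hq => ?_
    by_cases hpq : p = q
    · exact Filter.Eventually.of_forall fun t h => absurd hpq h
    · filter_upwards [eventually_flowZ_fst_ne (hn p hp) hp.2 hq.2 hpq,
        eventually_flowZ_snd_ne (hn p hp) hp.2 hq.2 hpq] with t h₁ h₂ _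
      exact ⟨h₁, h₂⟩
  obtain ⟨t, ht⟩ := hev.exists
  obtain ⟨K, hK⟩ := (hfin.image fun p => max ‖(flowZ t p).1‖ ‖(flowZ t p).2.1‖).bddAbove
  refine ⟨t, max K (r + 1), le_max_right _ _, fun p hp hpn => ?_⟩
  obtain ⟨⟨h₁, h₂⟩, h₃⟩ := ht p ⟨hp, hpn⟩
  have hmax := (hK ⟨p, ⟨hp, hpn⟩, rfl⟩).trans (le_max_left K (r + 1))
  exact ⟨⟨h₁, (le_max_left _ _).trans hmax⟩, ⟨h₂, (le_max_right _ _).trans hmax⟩,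
    fun q hq hqn => h₃ q ⟨hq, hqn⟩⟩

/-- Functions on the ordered Markov triples whose fibrewise values lie in consecutive annuli
and are fibrewise distinct are injective. -/
theorem injOn_of_annuli {R : ℕ → ℝ} (hR : Monotone R) {u : ℂ × ℂ × ℂ → ℂ}
    (hu : ∀ n : ℕ, ∀ p ∈ orderedMarkovTriples, p.2.2 = n → R n < ‖u p‖ ∧ ‖u p‖ ≤ R (n + 1))
    (hne : ∀ n : ℕ, ∀ p ∈ orderedMarkovTriples, p.2.2 = n →
      ∀ q ∈ orderedMarkovTriples, q.2.2 = n → p ≠ q → u p ≠ u q) :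
    orderedMarkovTriples.InjOn u := by
  intro p hp q hq hpq
  obtain ⟨m, -, hm⟩ := exists_nat_of_mem_orderedMarkovTriples hp
  obtain ⟨n, -, hn⟩ := exists_nat_of_mem_orderedMarkovTriples hq
  have hpm := hu m p hp hm
  have hqn := hu n q hq hn
  rw [hpq] at hpm
  rcases lt_trichotomy m n with h | rfl | h
  · linarith [hR (Nat.succ_le_of_lt h)]
  · by_contra hne'
    exact hne m p hp hm q hq hn hne' hpq
  · linarith [hR (Nat.succ_le_of_lt h)]

theorem finite_norm_le_of_lt_norm {u : ℂ × ℂ × ℂ → ℂ}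
    (hu : ∀ n : ℕ, ∀ p ∈ orderedMarkovTriples, p.2.2 = n → (n : ℝ) < ‖u p‖) (r : ℝ) :
    {p ∈ orderedMarkovTriples | ‖u p‖ ≤ r}.Finite := by
  refine ((Set.finite_Iic ⌊r⌋₊).biUnion
    fun n _ => finite_orderedMarkovTriples_fiber n).subset ?_
  rintro p ⟨hp, hr⟩
  obtain ⟨n, -, hn⟩ := exists_nat_of_mem_orderedMarkovTriples hp
  exact Set.mem_biUnion (Nat.le_floor ((hu n p hp hn).le.trans hr)) ⟨hp, hn⟩

/-- An entire shear along the `z`-fibres after which both the `x`- and the `y`-coordinate embed the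
ordered Markov triples as a closed discrete subset outside the unit disc. -/
theorem exists_entire_separating :
    ∃ f : ℂ → ℂ, Differentiable ℂ f ∧
      (orderedMarkovTriples.InjOn (fun p => (flowZ (f p.2.2) p).1) ∧
        (∀ p ∈ orderedMarkovTriples, 1 < ‖(flowZ (f p.2.2) p).1‖) ∧
        ∀ r : ℝ, {p ∈ orderedMarkovTriples | ‖(flowZ (f p.2.2) p).1‖ ≤ r}.Finite) ∧
      (orderedMarkovTriples.InjOn (fun p => (flowZ (f p.2.2) p).2.1) ∧
        (∀ p ∈ orderedMarkovTriples, 1 < ‖(flowZ (f p.2.2) p).2.1‖) ∧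
        ∀ r : ℝ, {p ∈ orderedMarkovTriples | ‖(flowZ (f p.2.2) p).2.1‖ ≤ r}.Finite) := by
  choose τ ρ hρ hτ using exists_time_fiber
  let R : ℕ → ℝ := fun n => Nat.rec 1 (fun n r => ρ n r) n
  have hRsucc : ∀ n, R n + 1 ≤ R (n + 1) := fun n => hρ n (R n)
  have hR : Monotone R := monotone_nat_of_le_succ fun n => by linarith [hRsucc n]
  have hRn : ∀ n : ℕ, (n : ℝ) + 1 ≤ R n := by
    intro n
    induction n with
    | zero => simp [R]
    | succ n ih => push_cast; linarith [hRsucc n]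
  obtain ⟨f, hf, hfv⟩ := exists_entire_interpolation (A := {n : ℕ | n ≠ 0})
    (c := fun n => (n : ℂ)) Nat.cast_injective.injOn (fun n hn => Nat.cast_ne_zero.mpr hn)
    (fun r => (Set.finite_Iic ⌊r⌋₊).subset fun n hn => Nat.le_floor (by simpa using hn.2))
    (fun n => τ n (R n))
  have key : ∀ n : ℕ, ∀ p ∈ orderedMarkovTriples, p.2.2 = n → f p.2.2 = τ n (R n) := by
    intro n p hp hpn
    obtain ⟨m, hm, hpm⟩ := exists_nat_of_mem_orderedMarkovTriples hp
    obtain rfl : m = n := Nat.cast_injective (hpm.symm.trans hpn)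
    rw [hpn]
    exact hfv m hm
  have aux : ∀ u : ℂ × ℂ × ℂ → ℂ,
      (∀ n : ℕ, ∀ p ∈ orderedMarkovTriples, p.2.2 = n → R n < ‖u p‖ ∧ ‖u p‖ ≤ R (n + 1)) →
      (∀ n : ℕ, ∀ p ∈ orderedMarkovTriples, p.2.2 = n →
        ∀ q ∈ orderedMarkovTriples, q.2.2 = n → p ≠ q → u p ≠ u q) →
      orderedMarkovTriples.InjOn u ∧ (∀ p ∈ orderedMarkovTriples, 1 < ‖u p‖) ∧
        ∀ r : ℝ, {p ∈ orderedMarkovTriples | ‖u p‖ ≤ r}.Finite := by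
    refine fun u hu hne => ⟨injOn_of_annuli hR hu hne, fun p hp => ?_,
      finite_norm_le_of_lt_norm fun n p hp hn => by linarith [hu n p hp hn, hRn n]⟩
    obtain ⟨n, -, hn⟩ := exists_nat_of_mem_orderedMarkovTriples hp
    linarith [hu n p hp hn, hRn n, n.cast_nonneg (α := ℝ)]
  refine ⟨f, hf, aux _ (fun n p hp hn => ?_) fun n p hp hpn q hq hqn hpq => ?_,
    aux _ (fun n p hp hn => ?_) fun n p hp hpn q hq hqn hpq => ?_⟩
  · rw [key n p hp hn]
    exact (hτ n (R n) p hp hn).1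
  · rw [key n p hp hpn, key n q hq hqn]
    exact ((hτ n (R n) p hp hpn).2.2 q hq hqn hpq).1
  · rw [key n p hp hn]
    exact (hτ n (R n) p hp hn).2.1
  · rw [key n p hp hpn, key n q hq hqn]
    exact ((hτ n (R n) p hp hpn).2.2 q hq hqn hpq).2

/-- Two points of the Markov surface are joined by a flow in a `y`-fibre followed by a flow in an
`x`-fibre. -/
theorem exists_flowX_flowY_eq {p q : ℂ × ℂ × ℂ} (hp : p ∈ markovSurface) (hq : q ∈ markovSurface)
    (hpy : 1 < ‖p.2.1‖) (hqx : 1 < ‖q.1‖) :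
    ∃ s t : ℂ, (flowY s p).1 = q.1 ∧ flowX t (flowY s p) = q := by
  obtain ⟨w, hw⟩ : ∃ w : ℂ, q.1 ^ 2 + p.2.1 ^ 2 + w ^ 2 = 3 * q.1 * p.2.1 * w := by
    obtain ⟨δ, hδ⟩ := IsAlgClosed.exists_pow_nat_eq
      ((3 * q.1 * p.2.1) ^ 2 - 4 * (q.1 ^ 2 + p.2.1 ^ 2)) zero_lt_two
    exact ⟨(3 * q.1 * p.2.1 + δ) / 2, by linear_combination hδ / 4⟩
  simp only [markovSurface, Set.mem_ofPred_eq] at hp hq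
  obtain ⟨s, hs₁, hs₂⟩ := exists_flow_conic (x := p.2.2) (y := p.1) (x' := w) (y' := q.1) hpy
    (by linear_combination hp) (by linear_combination hw)
  obtain ⟨t, ht₁, ht₂⟩ := exists_flow_conic (x := p.2.1) (y := w) (x' := q.2.1) (y' := q.2.2) hqx
    (by linear_combination hw) (by linear_combination hq)
  have hsp : flowY s p = (q.1, p.2.1, w) := by
    refine Prod.ext ?_ (Prod.ext rfl ?_)
    · simp only [flowY]
      linear_combination hs₂
    · simp only [flowY]
      linear_combination hs₁
  refine ⟨s, t, by rw [hsp], ?_⟩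
  rw [hsp]
  refine Prod.ext rfl (Prod.ext ?_ ?_)
  · simp only [flowX]
    linear_combination ht₁
  · simp only [flowX]
    linear_combination ht₂

/-- The ordered Markov triples form a tame subset of the Markov surface: for every
injective self-map `ι` of the set `T` of ordered Markov triples there exist entire
functions `f, g, h : ℂ → ℂ` such that the map `F = G⁻¹ ∘ Φ^x ∘ Φ^y ∘ G` — where
`G(p) = φ^z_{f(ζ(p))}(p)` with `ζ(p)` the `z`-coordinate of `p` (so that
`G⁻¹(q) = φ^z_{−f(ζ(q))}(q)`), `Φ^y(q) = φ^y_{g(υ(q))}(q)` with `υ(q)` the `y`-coordinate,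
and `Φ^x(q) = φ^x_{h(ξ(q))}(q)` with `ξ(q)` the `x`-coordinate — is a bijection of the
Markov surface `M₀` onto itself and satisfies `F(p) = ι(p)` for every `p ∈ T`. -/
theorem ordered_markov_triples_tame
    (ι : ℂ × ℂ × ℂ → ℂ × ℂ × ℂ)
    (hmaps : Set.MapsTo ι orderedMarkovTriples orderedMarkovTriples)
    (hinj : Set.InjOn ι orderedMarkovTriples) :
    ∃ f g h : ℂ → ℂ,
      Differentiable ℂ f ∧ Differentiable ℂ g ∧ Differentiable ℂ h ∧
      (let G : ℂ × ℂ × ℂ → ℂ × ℂ × ℂ := fun p => flowZ (f p.2.2) p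
       let Φy : ℂ × ℂ × ℂ → ℂ × ℂ × ℂ := fun q => flowY (g q.2.1) q
       let Φx : ℂ × ℂ × ℂ → ℂ × ℂ × ℂ := fun q => flowX (h q.1) q
       let Ginv : ℂ × ℂ × ℂ → ℂ × ℂ × ℂ := fun q => flowZ (-(f q.2.2)) q
       let F : ℂ × ℂ × ℂ → ℂ × ℂ × ℂ := fun p => Ginv (Φx (Φy (G p)))
       Set.BijOn F markovSurface markovSurface ∧
       ∀ p ∈ orderedMarkovTriples, F p = ι p) := by
  obtain ⟨f, hf, ⟨hxinj, hx1, hxfin⟩, ⟨hyinj, hy1, hyfin⟩⟩ := exists_entire_separating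
  have hmem : ∀ p ∈ orderedMarkovTriples, flowZ (f p.2.2) p ∈ markovSurface :=
    fun p hp => flowZ_mem_markovSurface _ hp.1
  choose! s t hs ht using fun p (hp : p ∈ orderedMarkovTriples) =>
    exists_flowX_flowY_eq (hmem p hp) (hmem _ (hmaps hp)) (hy1 p hp) (hx1 _ (hmaps hp))
  obtain ⟨g, hg, hgv⟩ := exists_entire_interpolation hyinj
    (fun p hp => norm_pos_iff.mp (zero_lt_one.trans (hy1 p hp))) hyfin s
  obtain ⟨h, hh, hhv⟩ := exists_entire_interpolation (hxinj.comp hinj hmaps)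
    (fun p hp => norm_pos_iff.mp (zero_lt_one.trans (hx1 _ (hmaps hp))))
    (fun r => Set.Finite.of_finite_image ((hxfin r).subset (by
      rintro _ ⟨p, ⟨hp, hr⟩, rfl⟩
      exact ⟨hmaps hp, hr⟩)) (hinj.mono fun p hp => hp.1)) t
  refine ⟨f, g, h, hf, hg, hh, ?_, fun p hp => ?_⟩
  · exact (bijOn_flowZ fun z => -f z).comp
      ((bijOn_flowX h).comp ((bijOn_flowY g).comp (bijOn_flowZ f)))
  · have hgp : g (flowZ (f p.2.2) p).2.1 = s p := hgv p hp
    have hhp : h (flowZ (f (ι p).2.2) (ι p)).1 = t p := hhv p hp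
    simp only [hgp, hs p hp, hhp, ht p hp]
    exact flowZ_neg_flowZ (f (ι p).2.2) (ι p)
end
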